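/- arXiv:1012.5240 — 5 statements merged into one kernel-verified Lean document; each statement's English description precedes it below -/
import Mathlib

section
/- Let P be a simple grid polygon and let ℓ ≥ 1 be an integer such that the ℓ-offset of P is nonempty. Then the ℓ-offset of P has at least 8ℓ fewer perimeter edges than P; that is, E(offset^ℓ(P)) ≤ E(P) − 8ℓ. -/
/-- A cell of the integer grid. -/
abbrev Cell : Type := ℤ × ℤ

/-- Two cells are edge-adjacent if they differ by exactly 1 in one coordinate
and 0 in the other. -/
def EdgeAdj (c d : Cell) : Prop :=
  (c.1 - d.1).natAbs + (c.2 - d.2).natAbs = 1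

/-- Two cells are touching if they are distinct and differ by at most 1
in each coordinate. -/
def Touching (c d : Cell) : Prop :=
  c ≠ d ∧ (c.1 - d.1).natAbs ≤ 1 ∧ (c.2 - d.2).natAbs ≤ 1

/-- A set of cells is connected under a relation `R` if any two of its members
are joined by a chain inside the set. -/
def ConnectedUnder (R : Cell → Cell → Prop) (S : Set Cell) : Prop :=
  ∀ c ∈ S, ∀ d ∈ S, Relation.ReflTransGen (fun a b => a ∈ S ∧ b ∈ S ∧ R a b) c d

/-- A grid polygon: a finite nonempty set of cells, connected under edge-adjacency. -/
def GridPolygon (P : Finset Cell) : Prop :=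
  P.Nonempty ∧ ConnectedUnder EdgeAdj (↑P : Set Cell)

/-- A simple grid polygon: a grid polygon whose complement is connected under
touching-adjacency (no holes). -/
def SimplePolygon (P : Finset Cell) : Prop :=
  GridPolygon P ∧ ConnectedUnder Touching ((↑P : Set Cell)ᶜ)

/-- The four edge-neighbors of a cell. -/
def nbrs (c : Cell) : Finset Cell :=
  {(c.1 + 1, c.2), (c.1 - 1, c.2), (c.1, c.2 + 1), (c.1, c.2 - 1)}

/-- The perimeter of a finite set of cells: the number of ordered pairs `(c, d)`
of edge-adjacent cells with `c ∈ S` and `d ∉ S`. -/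
def perimeter (S : Finset Cell) : ℕ :=
  ∑ c ∈ S, ((nbrs c).filter (fun d => d ∉ S)).card

/-- `w 0, …, w n` is a walk in `P`: all cells belong to `P` and consecutive
cells are edge-adjacent. -/
def IsWalk (P : Finset Cell) (w : ℕ → Cell) (n : ℕ) : Prop :=
  (∀ i ≤ n, w i ∈ P) ∧ ∀ i < n, EdgeAdj (w i) (w (i + 1))

/-- The walk `w 0, …, w n` covers `P`: every cell of `P` occurs among the `w i`. -/
def Covers (P : Finset Cell) (w : ℕ → Cell) (n : ℕ) : Prop :=
  ∀ c ∈ P, ∃ i ≤ n, w i = c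

/-- The eight cells touching a cell. -/
def touchNbrs (c : Cell) : Finset Cell :=
  {(c.1 + 1, c.2), (c.1 - 1, c.2), (c.1, c.2 + 1), (c.1, c.2 - 1),
   (c.1 + 1, c.2 + 1), (c.1 + 1, c.2 - 1), (c.1 - 1, c.2 + 1), (c.1 - 1, c.2 - 1)}

/-- The offset of a set of cells: the cells all of whose touching cells
belong to the set (the set with its first layer removed). -/
def offset (S : Finset Cell) : Finset Cell :=
  S.filter (fun c => touchNbrs c ⊆ S)

namespace OffsetProof

/-- Erosion by the domino {0, e}. -/
def er (e : Cell) (S : Finset Cell) : Finset Cell := S.filter (fun c => c + e ∈ S)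

theorem mem_er {e c : Cell} {S : Finset Cell} : c ∈ er e S ↔ c ∈ S ∧ c + e ∈ S := by
  simp [er]

theorem er_comm (e f : Cell) (S : Finset Cell) : er e (er f S) = er f (er e S) := by
  ext c
  simp only [mem_er, add_right_comm c e f]
  tauto

theorem card_er_neg (e : Cell) (S : Finset Cell) : (er (-e) S).card = (er e S).card := by
  have : er (-e) S = (er e S).image (fun c => c + e) := by
    ext c
    simp only [mem_er, Finset.mem_image]
    constructor
    · rintro ⟨h1, h2⟩
      exact ⟨c + -e, ⟨h2, by simpa using h1⟩, by simp⟩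
    · rintro ⟨a, ⟨h1, h2⟩, rfl⟩
      exact ⟨h2, by simpa using h1⟩
  rw [this, Finset.card_image_of_injective _ (add_left_injective e)]

abbrev e1 : Cell := (1, 0)
abbrev e2 : Cell := (0, 1)

theorem card_filter_not (e : Cell) (S : Finset Cell) :
    ∑ c ∈ S, (if c + e ∉ S then (1 : ℤ) else 0) = S.card - (er e S).card := by
  have h := Finset.card_filter_add_card_filter_not (s := S) (fun c => c + e ∈ S)
  rw [Finset.sum_boole]
  unfold er
  rw [← h]; push_cast; ring

theorem perimeter_eq (S : Finset Cell) :
    (perimeter S : ℤ) = 4 * S.card - 2 * (er e1 S).card - 2 * (er e2 S).card := by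
  have h : ∀ c : Cell, (((nbrs c).filter (fun d => d ∉ S)).card : ℤ) =
      (if c + e1 ∉ S then (1 : ℤ) else 0) + (if c + -e1 ∉ S then (1 : ℤ) else 0)
      + (if c + e2 ∉ S then (1 : ℤ) else 0) + (if c + -e2 ∉ S then (1 : ℤ) else 0) := by
    rintro ⟨x, y⟩
    rw [Finset.card_filter]
    unfold nbrs
    rw [Finset.sum_insert, Finset.sum_insert, Finset.sum_insert, Finset.sum_singleton]
    · simp [e1, e2, sub_eq_add_neg]; ring
    · simp; omega
    · simp
    · simp; omega
  unfold perimeter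
  push_cast
  rw [Finset.sum_congr rfl (fun c _ => h c)]
  simp only [Finset.sum_add_distrib, card_filter_not, card_er_neg]
  ring

def chi (S : Finset Cell) : ℤ :=
  S.card - (er e1 S).card - (er e2 S).card + (er e2 (er e1 S)).card

abbrev Conn (S : Finset Cell) : Cell → Cell → Prop :=
  Relation.ReflTransGen (fun a b => a ∈ S ∧ b ∈ S ∧ EdgeAdj a b)

def Good (S : Finset Cell) : Prop :=
  ∃ R : Finset Cell, (R.card : ℤ) ≤ chi S ∧ ∀ x ∈ S, ∃ r ∈ R, Conn S x r

theorem edgeAdj_symm {a b : Cell} (h : EdgeAdj a b) : EdgeAdj b a := by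
  unfold EdgeAdj at *; omega

theorem conn_symm {S : Finset Cell} {a b : Cell} (h : Conn S a b) : Conn S b a := by
  induction h with
  | refl => exact .refl
  | tail _ h ih => exact Relation.ReflTransGen.head ⟨h.2.1, h.1, edgeAdj_symm h.2.2⟩ ih

theorem er_erase (e c : Cell) (S : Finset Cell) :
    er e (S.erase c) = ((er e S).erase c).erase (c - e) := by
  ext a
  simp only [mem_er, Finset.mem_erase, ne_eq, eq_sub_iff_add_eq]
  tauto

theorem card_erase' (X : Finset Cell) (a : Cell) :
    ((X.erase a).card : ℤ) = X.card - (if a ∈ X then 1 else 0) := by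
  split_ifs with h
  · have := Finset.card_erase_add_one h
    omega
  · simp [Finset.erase_eq_of_notMem h]

theorem chi_erase (S : Finset Cell) (x y : ℤ) (hc : (x, y) ∈ S) :
    chi (S.erase (x, y)) = chi S - 1
      + (if (x+1, y) ∈ S then 1 else 0) + (if (x, y+1) ∈ S then 1 else 0)
      + (if (x-1, y) ∈ S then 1 else 0) + (if (x, y-1) ∈ S then 1 else 0)
      - (if (x+1, y) ∈ S ∧ (x+1, y+1) ∈ S ∧ (x, y+1) ∈ S then 1 else 0)
      - (if (x, y+1) ∈ S ∧ (x-1, y+1) ∈ S ∧ (x-1, y) ∈ S then 1 else 0)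
      - (if (x-1, y) ∈ S ∧ (x-1, y-1) ∈ S ∧ (x, y-1) ∈ S then 1 else 0)
      - (if (x, y-1) ∈ S ∧ (x+1, y-1) ∈ S ∧ (x+1, y) ∈ S then 1 else 0) := by
  unfold chi
  simp only [er_erase, card_erase', Finset.mem_erase, mem_er, e1, e2, hc]
  simp only [Prod.mk_add_mk, Prod.mk_sub_mk, sub_zero, add_zero, sub_add_cancel, ne_eq,
    Prod.mk.injEq, hc, sub_eq_self, add_eq_left, true_and, and_true, one_ne_zero, not_false_eq_true,
    false_and, and_false, not_true, if_true, sub_add_cancel]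
  have a1 : ((x + 1, y) ∈ S ∧ (x, y+1) ∈ S ∧ (x+1,y+1) ∈ S) ↔
    ((x+1, y) ∈ S ∧ (x+1, y+1) ∈ S ∧ (x, y+1) ∈ S) := by tauto
  have a2 : (((x, y - 1) ∈ S ∧ (x + 1, y - 1) ∈ S) ∧ (x + 1, y) ∈ S) ↔
    ((x, y-1) ∈ S ∧ (x+1, y-1) ∈ S ∧ (x+1, y) ∈ S) := by tauto
  have a3 : ((x - 1, y) ∈ S ∧ (x - 1, y + 1) ∈ S ∧ (x, y + 1) ∈ S) ↔
    ((x, y+1) ∈ S ∧ (x-1, y+1) ∈ S ∧ (x-1, y) ∈ S) := by tauto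
  have a4 : (((x - 1, y - 1) ∈ S ∧ (x, y - 1) ∈ S) ∧ (x - 1, y) ∈ S) ↔
    ((x-1, y) ∈ S ∧ (x-1, y-1) ∈ S ∧ (x, y-1) ∈ S) := by tauto
  rw [if_congr a1 rfl rfl, if_congr a2 rfl rfl, if_congr a3 rfl rfl, if_congr a4 rfl rfl]
  ring

theorem local_rep (S : Finset Cell) (x y : ℤ) (hc : (x, y) ∈ S)
    (hd : ∃ d, Touching (x, y) d ∧ d ∉ S) :
    ∃ A : Finset Cell, chi S + A.card ≤ chi (S.erase (x, y)) + 1 ∧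
      ∀ n ∈ S, EdgeAdj (x, y) n → ∃ r ∈ A, Conn (S.erase (x, y)) n r := by
  let g : Prop → Prop → Prop → Cell → Finset Cell := fun p q p' n =>
    open Classical in if p ∧ ¬ (q ∧ p') then {n} else ∅
  have hg : ∀ (p q p' : Prop) (n : Cell) [Decidable p] [Decidable q] [Decidable p'], ((g p q p' n).card : ℤ) = (if p then 1 else 0)
      - (if p ∧ q ∧ p' then 1 else 0) := by
    intro p q p' n _ _ _
    by_cases p <;> by_cases q <;> by_cases p' <;> simp_all [g]
  have hg' : ∀ p q p' n, p → (n ∈ g p q p' n ∨ (q ∧ p')) := by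
    intro p q p' n hp
    by_cases h : q ∧ p'
    · exact Or.inr h
    · left; simp only [g]; rw [if_pos ⟨hp, h⟩]; simp
  let A0 := g ((x+1, y) ∈ S) ((x+1, y+1) ∈ S) ((x, y+1) ∈ S) (x+1, y)
  let A1 := g ((x, y+1) ∈ S) ((x-1, y+1) ∈ S) ((x-1, y) ∈ S) (x, y+1)
  let A2 := g ((x-1, y) ∈ S) ((x-1, y-1) ∈ S) ((x, y-1) ∈ S) (x-1, y)
  let A3 := g ((x, y-1) ∈ S) ((x+1, y-1) ∈ S) ((x+1, y) ∈ S) (x, y-1)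
  refine ⟨A0 ∪ A1 ∪ A2 ∪ A3, ?_, ?_⟩
  · have h1 := Finset.card_union_le (A0 ∪ A1 ∪ A2) A3
    have h2 := Finset.card_union_le (A0 ∪ A1) A2
    have h3 := Finset.card_union_le A0 A1
    have k0 := hg ((x+1, y) ∈ S) ((x+1, y+1) ∈ S) ((x, y+1) ∈ S) (x+1, y)
    have k1 := hg ((x, y+1) ∈ S) ((x-1, y+1) ∈ S) ((x-1, y) ∈ S) (x, y+1)
    have k2 := hg ((x-1, y) ∈ S) ((x-1, y-1) ∈ S) ((x, y-1) ∈ S) (x-1, y)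
    have k3 := hg ((x, y-1) ∈ S) ((x+1, y-1) ∈ S) ((x+1, y) ∈ S) (x, y-1)
    change (A0.card : ℤ) = _ at k0
    change (A1.card : ℤ) = _ at k1
    change (A2.card : ℤ) = _ at k2
    change (A3.card : ℤ) = _ at k3
    rw [chi_erase S x y hc]
    zify at h1 h2 h3
    linarith
  · have two : ∀ a b c : Cell, a ∈ S → b ∈ S → c ∈ S → EdgeAdj a b → EdgeAdj b c →
        a ≠ (x, y) → b ≠ (x, y) → c ≠ (x, y) → Conn (S.erase (x, y)) a c := by
      intro a b c ha hb hc hab hbc na nb nc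
      exact .head ⟨by simp [*], by simp [*], hab⟩ (.single ⟨by simp [*], by simp [*], hbc⟩)
    set A := A0 ∪ A1 ∪ A2 ∪ A3 with hA
    have s0 : (x+1, y) ∈ S → ((x+1, y) ∈ A ∨ ((x+1, y+1) ∈ S ∧ (x, y+1) ∈ S ∧
        Conn (S.erase (x, y)) (x+1, y) (x, y+1))) := by
      intro h
      rcases hg' _ ((x+1, y+1) ∈ S) ((x, y+1) ∈ S) (x+1, y) h with h' | ⟨h1, h2⟩
      · left; simp only [hA, Finset.mem_union]; tauto
      · right; exact ⟨h1, h2, two _ _ _ h h1 h2 (by simp [EdgeAdj]) (by simp [EdgeAdj])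
          (by simp) (by simp) (by simp)⟩
    have s1 : (x, y+1) ∈ S → ((x, y+1) ∈ A ∨ ((x-1, y+1) ∈ S ∧ (x-1, y) ∈ S ∧
        Conn (S.erase (x, y)) (x, y+1) (x-1, y))) := by
      intro h
      rcases hg' _ ((x-1, y+1) ∈ S) ((x-1, y) ∈ S) (x, y+1) h with h' | ⟨h1, h2⟩
      · left; simp only [hA, Finset.mem_union]; tauto
      · right; exact ⟨h1, h2, two _ _ _ h h1 h2 (by simp [EdgeAdj]) (by simp [EdgeAdj])
          (by simp) (by simp) (by simp)⟩
    have s2 : (x-1, y) ∈ S → ((x-1, y) ∈ A ∨ ((x-1, y-1) ∈ S ∧ (x, y-1) ∈ S ∧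
        Conn (S.erase (x, y)) (x-1, y) (x, y-1))) := by
      intro h
      rcases hg' _ ((x-1, y-1) ∈ S) ((x, y-1) ∈ S) (x-1, y) h with h' | ⟨h1, h2⟩
      · left; simp only [hA, Finset.mem_union]; tauto
      · right; exact ⟨h1, h2, two _ _ _ h h1 h2 (by simp [EdgeAdj]) (by simp [EdgeAdj])
          (by simp) (by simp) (by simp)⟩
    have s3 : (x, y-1) ∈ S → ((x, y-1) ∈ A ∨ ((x+1, y-1) ∈ S ∧ (x+1, y) ∈ S ∧
        Conn (S.erase (x, y)) (x, y-1) (x+1, y))) := by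
      intro h
      rcases hg' _ ((x+1, y-1) ∈ S) ((x+1, y) ∈ S) (x, y-1) h with h' | ⟨h1, h2⟩
      · left; simp only [hA, Finset.mem_union]; tauto
      · right; exact ⟨h1, h2, two _ _ _ h h1 h2 (by simp [EdgeAdj]) (by simp [EdgeAdj])
          (by simp) (by simp) (by simp)⟩
    have hne : ¬ ((x+1, y) ∈ S ∧ (x+1, y+1) ∈ S ∧ (x, y+1) ∈ S ∧ (x-1, y+1) ∈ S ∧
        (x-1, y) ∈ S ∧ (x-1, y-1) ∈ S ∧ (x, y-1) ∈ S ∧ (x+1, y-1) ∈ S) := by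
      rintro ⟨h0, h1, h2, h3, h4, h5, h6, h7⟩
      obtain ⟨⟨a, b⟩, ⟨hn, ha, hb⟩, hd⟩ := hd
      simp only at ha hb
      have ha' : a = x - 1 ∨ a = x ∨ a = x + 1 := by omega
      have hb' : b = y - 1 ∨ b = y ∨ b = y + 1 := by omega
      rcases ha' with rfl | rfl | rfl <;> rcases hb' with rfl | rfl | rfl <;> 
        first | exact hd ‹_› | exact hn rfl
    have key : ∀ n, n ∈ A → ∃ r ∈ A, Conn (S.erase (x, y)) n r := fun n h => ⟨n, h, .refl⟩
    have tr : ∀ m n, Conn (S.erase (x, y)) m n → (∃ r ∈ A, Conn (S.erase (x, y)) n r) →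
        ∃ r ∈ A, Conn (S.erase (x, y)) m r := fun m n h ⟨r, hr, h'⟩ => ⟨r, hr, h.trans h'⟩
    rintro ⟨a, b⟩ hn hadj
    simp only [EdgeAdj] at hadj
    have : (a = x + 1 ∧ b = y) ∨ (a = x ∧ b = y + 1) ∨ (a = x - 1 ∧ b = y) ∨
        (a = x ∧ b = y - 1) := by omega
    generalize hQ : (fun n => ∃ r ∈ A, Conn (S.erase (x, y)) n r) = Q at *
    have key : ∀ n, n ∈ A → Q n := by rw [← hQ]; exact key
    have tr : ∀ m n, Conn (S.erase (x, y)) m n → Q n → Q m := by rw [← hQ]; exact tr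
    change (fun n => ∃ r ∈ A, Conn (S.erase (x, y)) n r) (a, b)
    rw [hQ]
    have t0 := tr (x+1, y) (x, y+1)
    have t1 := tr (x, y+1) (x-1, y)
    have t2 := tr (x-1, y) (x, y-1)
    have t3 := tr (x, y-1) (x+1, y)
    have u0 := key (x+1, y)
    have u1 := key (x, y+1)
    have u2 := key (x-1, y)
    have u3 := key (x, y-1)
    clear tr key two hg hg' hd
    rcases this with ⟨rfl, rfl⟩ | ⟨rfl, rfl⟩ | ⟨rfl, rfl⟩ | ⟨rfl, rfl⟩
    · rcases s0 hn with h | ⟨_, h0, h⟩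
      · exact u0 h
      refine t0 h ?_
      rcases s1 h0 with h | ⟨_, h0, h⟩
      · exact u1 h
      refine t1 h ?_
      rcases s2 h0 with h | ⟨_, h0, h⟩
      · exact u2 h
      refine t2 h ?_
      rcases s3 h0 with h | ⟨_, h0, h⟩
      · exact u3 h
      exact (hne (by refine ⟨?_, ?_, ?_, ?_, ?_, ?_, ?_, ?_⟩ <;> assumption)).elim
    · rcases s1 hn with h | ⟨_, h0, h⟩
      · exact u1 h
      refine t1 h ?_
      rcases s2 h0 with h | ⟨_, h0, h⟩
      · exact u2 h
      refine t2 h ?_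
      rcases s3 h0 with h | ⟨_, h0, h⟩
      · exact u3 h
      refine t3 h ?_
      rcases s0 h0 with h | ⟨_, h0, h⟩
      · exact u0 h
      exact (hne (by refine ⟨?_, ?_, ?_, ?_, ?_, ?_, ?_, ?_⟩ <;> assumption)).elim
    · rcases s2 hn with h | ⟨_, h0, h⟩
      · exact u2 h
      refine t2 h ?_
      rcases s3 h0 with h | ⟨_, h0, h⟩
      · exact u3 h
      refine t3 h ?_
      rcases s0 h0 with h | ⟨_, h0, h⟩
      · exact u0 h
      refine t0 h ?_
      rcases s1 h0 with h | ⟨_, h0, h⟩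
      · exact u1 h
      exact (hne (by refine ⟨?_, ?_, ?_, ?_, ?_, ?_, ?_, ?_⟩ <;> assumption)).elim
    · rcases s3 hn with h | ⟨_, h0, h⟩
      · exact u3 h
      refine t3 h ?_
      rcases s0 h0 with h | ⟨_, h0, h⟩
      · exact u0 h
      refine t0 h ?_
      rcases s1 h0 with h | ⟨_, h0, h⟩
      · exact u1 h
      refine t1 h ?_
      rcases s2 h0 with h | ⟨_, h0, h⟩
      · exact u2 h
      exact (hne (by refine ⟨?_, ?_, ?_, ?_, ?_, ?_, ?_, ?_⟩ <;> assumption)).elim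

theorem conn_avoid {S : Finset Cell} {c x r : Cell} (h : Conn S x r) (hx : ¬ Conn S x c) :
    Conn (S.erase c) x r := by
  induction h using Relation.ReflTransGen.head_induction_on with
  | refl => exact .refl
  | head h _ ih =>
    rename_i a b _
    have hb : ¬ Conn S b c := fun hb => hx (.head h hb)
    refine .head ⟨?_, ?_, h.2.2⟩ (ih hb)
    · exact Finset.mem_erase.2 ⟨fun e => hx (e ▸ .refl), h.1⟩
    · exact Finset.mem_erase.2 ⟨fun e => hb (e ▸ .refl), h.2.1⟩

theorem conn_to {S : Finset Cell} {c x : Cell} (h : Conn S x c) :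
    x = c ∨ ∃ n ∈ S, EdgeAdj c n ∧ Conn (S.erase c) x n := by
  induction h using Relation.ReflTransGen.head_induction_on with
  | refl => exact Or.inl rfl
  | head h _ ih =>
    rename_i a b _
    by_cases ha : a = c
    · exact Or.inl ha
    right
    rcases ih with rfl | ⟨n, hn, hcn, hbn⟩
    · exact ⟨a, h.1, edgeAdj_symm h.2.2, .refl⟩
    · by_cases hb : b = c
      · subst hb
        exact ⟨a, h.1, edgeAdj_symm h.2.2, .refl⟩
      · exact ⟨n, hn, hcn, .head ⟨by simp [ha, h.1], by simp [hb, h.2.1], h.2.2⟩ hbn⟩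

theorem good_erase {S : Finset Cell} {c : Cell} (hS : Good S) (hc : c ∈ S)
    (hd : ∃ d, Touching c d ∧ d ∉ S) : Good (S.erase c) := by
  classical
  obtain ⟨x, y⟩ := c
  obtain ⟨A, hA, hA'⟩ := local_rep S x y hc hd
  obtain ⟨R, hR, hR'⟩ := hS
  obtain ⟨r, hr, hcr⟩ := hR' _ hc
  refine ⟨R.erase r ∪ A, ?_, ?_⟩
  · have h1 := Finset.card_union_le (R.erase r) A
    have h2 := Finset.card_erase_add_one hr
    omega
  · intro z hz
    have hz' := Finset.mem_erase.1 hz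
    by_cases hzc : Conn S z (x, y)
    · rcases conn_to hzc with h | ⟨n, hn, hcn, h⟩
      · exact absurd h hz'.1
      · obtain ⟨q, hq, hq'⟩ := hA' n hn hcn
        exact ⟨q, by simp [hq], h.trans hq'⟩
    · obtain ⟨q, hq, hq'⟩ := hR' z hz'.2
      refine ⟨q, ?_, conn_avoid hq' hzc⟩
      have : q ≠ r := by
        rintro rfl
        exact hzc (hq'.trans (conn_symm hcr))
      simp [this, hq]

theorem first_step {S T : Set Cell} (hST : S ⊆ T) {d c : Cell}
    (h : Relation.ReflTransGen (fun a b => a ∈ Sᶜ ∧ b ∈ Sᶜ ∧ Touching a b) d c)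
    (hd : d ∉ T) (hc : c ∈ T) : ∃ a b, a ∉ T ∧ b ∈ T ∧ b ∉ S ∧ Touching a b := by
  induction h with
  | refl => exact absurd hc hd
  | tail _ h ih =>
    rename_i b c _
    by_cases hb : b ∈ T
    · exact ih hb
    · exact ⟨b, c, hb, hc, h.2.1, h.2.2⟩

theorem touching_symm {a b : Cell} (h : Touching a b) : Touching b a := by
  obtain ⟨h1, h2, h3⟩ := h
  exact ⟨h1.symm, by omega, by omega⟩

theorem good_of_superset (S : Finset Cell) (hco : ConnectedUnder Touching ((↑S : Set Cell)ᶜ))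
    (n : ℕ) : ∀ T : Finset Cell, S ⊆ T → (T \ S).card = n → Good T → Good S := by
  induction n with
  | zero =>
    intro T hST h hT
    have : T ⊆ S := by
      rw [← Finset.sdiff_eq_empty_iff_subset]; exact Finset.card_eq_zero.1 h
    rwa [Finset.Subset.antisymm hST this]
  | succ n ih =>
    intro T hST h hT
    obtain ⟨c0, hc0⟩ : (T \ S).Nonempty := Finset.card_pos.1 (by omega)
    rw [Finset.mem_sdiff] at hc0
    obtain ⟨d, hd⟩ := Infinite.exists_notMem_finset T
    obtain ⟨a, b, ha, hb, hbS, hab⟩ := first_step (S := ↑S) (T := ↑T) (by exact_mod_cast hST)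
      (hco d (by simpa using fun h => hd (hST h)) c0 (by simpa using hc0.2))
      (by simpa using hd) (by simpa using hc0.1)
    simp only [Finset.mem_coe] at ha hb hbS
    refine ih (T.erase b) ?_ ?_ (good_erase hT hb ⟨a, touching_symm hab, ha⟩)
    · exact Finset.subset_erase.2 ⟨hST, hbS⟩
    · rw [Finset.erase_sdiff_comm, Finset.card_erase_of_mem (by simp [hb, hbS]), h]; rfl

noncomputable def box (n : ℕ) : Finset Cell := Finset.Icc (-(n:ℤ)) n ×ˢ Finset.Icc (-(n:ℤ)) n

theorem mem_box {n : ℕ} {x y : ℤ} : (x, y) ∈ box n ↔ (-(n:ℤ) ≤ x ∧ x ≤ n) ∧ -(n:ℤ) ≤ y ∧ y ≤ n := by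
  simp [box]

theorem good_box (n : ℕ) : Good (box n) := by
  refine ⟨{(-(n:ℤ), -(n:ℤ))}, ?_, ?_⟩
  · have h1 : er e1 (box n) = Finset.Icc (-(n:ℤ)) (n-1) ×ˢ Finset.Icc (-(n:ℤ)) n := by
      ext ⟨x, y⟩; simp [mem_er, box]; omega
    have h2 : er e2 (box n) = Finset.Icc (-(n:ℤ)) n ×ˢ Finset.Icc (-(n:ℤ)) (n-1) := by
      ext ⟨x, y⟩; simp [mem_er, box]; omega
    have h3 : er e2 (er e1 (box n)) = Finset.Icc (-(n:ℤ)) (n-1) ×ˢ Finset.Icc (-(n:ℤ)) (n-1) := by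
      ext ⟨x, y⟩; simp [mem_er, box]; omega
    have k1 : (((n:ℤ) + 1 - -(n:ℤ)).toNat : ℤ) = 2 * n + 1 := by omega
    have k2 : (((n:ℤ) - 1 + 1 - -(n:ℤ)).toNat : ℤ) = 2 * n := by omega
    unfold chi
    rw [h3, h1, h2, box]
    simp only [Finset.card_product, Int.card_Icc, Nat.cast_mul, k1, k2, Finset.card_singleton]
    push_cast
    nlinarith
  · have key : ∀ k : ℕ, ∀ x y : ℤ, (x, y) ∈ box n → (x + n).toNat + (y + n).toNat = k →
        Conn (box n) (x, y) (-(n:ℤ), -(n:ℤ)) := by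
      intro k
      induction k with
      | zero =>
        intro x y h hk
        rw [mem_box] at h
        obtain rfl : x = -n := by omega
        obtain rfl : y = -n := by omega
        exact .refl
      | succ k ih =>
        intro x y h hk
        have h' := h
        rw [mem_box] at h
        by_cases hx : x = -n
        · have hm : (x, y - 1) ∈ box n := by rw [mem_box]; omega
          exact .head ⟨h', hm, by simp [EdgeAdj]⟩ (ih _ _ hm (by omega))
        · have hm : (x - 1, y) ∈ box n := by rw [mem_box]; omega
          exact .head ⟨h', hm, by simp [EdgeAdj]⟩ (ih _ _ hm (by omega))
    rintro ⟨x, y⟩ h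
    exact ⟨_, Finset.mem_singleton_self _, key _ x y h rfl⟩

theorem exists_box (S : Finset Cell) : ∃ n, S ⊆ box n := by
  refine ⟨∑ c ∈ S, (c.1.natAbs + c.2.natAbs), ?_⟩
  rintro ⟨x, y⟩ h
  have := Finset.single_le_sum (f := fun c : Cell => c.1.natAbs + c.2.natAbs)
    (fun _ _ => Nat.zero_le _) h
  rw [mem_box]
  simp only at this
  omega

theorem chi_pos (S : Finset Cell) (hco : ConnectedUnder Touching ((↑S : Set Cell)ᶜ))
    (hne : S.Nonempty) : 1 ≤ chi S := by
  obtain ⟨n, hn⟩ := exists_box S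
  obtain ⟨R, hR, hR'⟩ := good_of_superset S hco _ (box n) hn rfl (good_box n)
  obtain ⟨x, hx⟩ := hne
  obtain ⟨r, hr, _⟩ := hR' x hx
  have := Finset.card_pos.2 ⟨r, hr⟩
  omega

theorem er_er_ineq (e : Cell) (S : Finset Cell) :
    2 * ((er e S).card : ℤ) ≤ S.card + (er e (er e S)).card := by
  have h1 : (er e S ∩ er (-e) S).card = (er e (er e S)).card := by
    rw [← card_er_neg e (er e S)]
    congr 1
    ext c
    simp only [mem_er, Finset.mem_inter, neg_add_cancel_right]
    tauto
  have h2 := Finset.card_union_add_card_inter (er e S) (er (-e) S)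
  have h3 : (er e S ∪ er (-e) S).card ≤ S.card :=
    Finset.card_le_card (Finset.union_subset (Finset.filter_subset _ _) (Finset.filter_subset _ _))
  rw [h1, card_er_neg] at h2
  omega

def CoConn (S : Finset Cell) : Prop := ConnectedUnder Touching ((↑S : Set Cell)ᶜ)

theorem step1 (S : Finset Cell) (hco : CoConn S) (hne : S.Nonempty) (e : Cell)
    (he : e = e1 ∨ e = -e1 ∨ e = e2 ∨ e = -e2) :
    perimeter (er e S) + 2 ≤ perimeter S := by
  have hc := chi_pos S hco hne
  unfold chi at hc
  have h := er_er_ineq e S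
  have p := perimeter_eq S
  have q := perimeter_eq (er e S)
  rcases he with rfl | rfl | rfl | rfl
  · omega
  · rw [← card_er_neg e1 (er (-e1) S), er_comm e2, card_er_neg e1 (er e2 S), er_comm e1,
      card_er_neg] at q
    rw [card_er_neg] at h
    omega
  · rw [er_comm e1] at q
    omega
  · rw [← card_er_neg e2 (er (-e2) S), er_comm e1, card_er_neg e2 (er e1 S),
      card_er_neg] at q
    rw [card_er_neg] at h
    omega

theorem coConn_er (S : Finset Cell) (hco : CoConn S) (e : Cell)
    (he : e = e1 ∨ e = -e1 ∨ e = e2 ∨ e = -e2) : CoConn (er e S) := by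
  have mono : ∀ c d, Relation.ReflTransGen
      (fun a b => a ∈ (↑S : Set Cell)ᶜ ∧ b ∈ (↑S : Set Cell)ᶜ ∧ Touching a b) c d →
      Relation.ReflTransGen (fun a b => a ∈ (↑(er e S) : Set Cell)ᶜ ∧ b ∈ (↑(er e S) : Set Cell)ᶜ
        ∧ Touching a b) c d := by
    intro c d h
    refine Relation.ReflTransGen.mono ?_ _ _ h
    rintro a b ⟨h1, h2, h3⟩
    simp only [Set.mem_compl_iff, Finset.mem_coe] at *
    exact ⟨fun h => h1 (mem_er.1 h).1, fun h => h2 (mem_er.1 h).1, h3⟩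
  have ht : ∀ c, Touching c (c + e) := by
    rintro ⟨x, y⟩
    rcases he with rfl | rfl | rfl | rfl <;> simp [Touching, e1, e2]
  have out : ∀ c ∈ (↑(er e S) : Set Cell)ᶜ, ∃ c' ∈ (↑S : Set Cell)ᶜ,
      Relation.ReflTransGen (fun a b => a ∈ (↑(er e S) : Set Cell)ᶜ ∧ b ∈ (↑(er e S) : Set Cell)ᶜ
        ∧ Touching a b) c c' ∧
      Relation.ReflTransGen (fun a b => a ∈ (↑(er e S) : Set Cell)ᶜ ∧ b ∈ (↑(er e S) : Set Cell)ᶜ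
        ∧ Touching a b) c' c := by
    intro c hc
    by_cases h : c ∈ S
    · have h2 : c + e ∉ S := fun h2 => hc (by simpa using mem_er.2 ⟨h, h2⟩)
      have h3 : c + e ∈ (↑(er e S) : Set Cell)ᶜ := by
        simp only [Set.mem_compl_iff, Finset.mem_coe]
        exact fun h => h2 (mem_er.1 h).1
      exact ⟨c + e, by simpa using h2, .single ⟨hc, h3, ht c⟩,
        .single ⟨h3, hc, touching_symm (ht c)⟩⟩
    · exact ⟨c, by simpa using h, .refl, .refl⟩
  intro c hc d hd
  obtain ⟨c', hc', h1, -⟩ := out c hc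
  obtain ⟨d', hd', -, h2⟩ := out d hd
  exact h1.trans ((mono _ _ (hco c' hc' d' hd')).trans h2)

theorem offset_eq (S : Finset Cell) : offset S = er e1 (er (-e1) (er e2 (er (-e2) S))) := by
  ext ⟨x, y⟩
  simp only [offset, touchNbrs, Finset.mem_filter, Finset.insert_subset_iff,
    Finset.singleton_subset_iff, mem_er, e1, e2, Prod.mk_add_mk, Prod.neg_mk, neg_zero, add_zero,
    ← sub_eq_add_neg, add_sub_cancel_right, sub_add_cancel]
  tauto

theorem er_sub (e : Cell) (S : Finset Cell) (h : (er e S).Nonempty) : S.Nonempty :=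
  h.mono (Finset.filter_subset _ _)

theorem offset_step (S : Finset Cell) (hco : CoConn S) (hne : (offset S).Nonempty) :
    CoConn (offset S) ∧ perimeter (offset S) + 8 ≤ perimeter S := by
  rw [offset_eq] at *
  have n1 := er_sub _ _ hne
  have n2 := er_sub _ _ n1
  have n3 := er_sub _ _ n2
  have n4 := er_sub _ _ n3
  have c1 := coConn_er S hco (-e2) (by tauto)
  have c2 := coConn_er _ c1 e2 (by tauto)
  have c3 := coConn_er _ c2 (-e1) (by tauto)
  have c4 := coConn_er _ c3 e1 (by tauto)
  refine ⟨c4, ?_⟩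
  have p1 := step1 S hco n4 (-e2) (by tauto)
  have p2 := step1 _ c1 n3 e2 (by tauto)
  have p3 := step1 _ c2 n2 (-e1) (by tauto)
  have p4 := step1 _ c3 n1 e1 (by tauto)
  omega

theorem main (ℓ : ℕ) : ∀ S : Finset Cell, CoConn S → (offset^[ℓ] S).Nonempty →
    CoConn (offset^[ℓ] S) ∧ perimeter (offset^[ℓ] S) + 8 * ℓ ≤ perimeter S := by
  induction ℓ with
  | zero => intro S h _; exact ⟨h, by simp⟩
  | succ n ih =>
    intro S h hne
    rw [Function.iterate_succ_apply'] at *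
    obtain ⟨h1, h2⟩ := ih S h (hne.mono (Finset.filter_subset _ _))
    obtain ⟨h3, h4⟩ := offset_step _ h1 hne
    exact ⟨h3, by omega⟩

end OffsetProof

/-- if the `ℓ`-offset (`ℓ ≥ 1`) of a simple grid polygon is
nonempty, it has at least `8ℓ` fewer perimeter edges than the polygon. -/
theorem offset_perimeter_bound (P : Finset Cell) (hP : SimplePolygon P)
    (ℓ : ℕ) (hℓ : 1 ≤ ℓ) (hne : (offset^[ℓ] P).Nonempty) :
    perimeter (offset^[ℓ] P) + 8 * ℓ ≤ perimeter P :=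
  (OffsetProof.main ℓ P hP.2 hne).2
end

section
/- For all finite sets A and B of cells, the perimeter satisfies E(A ∪ B) + E(A ∩ B) ≤ E(A) + E(B). -/
theorem perimeter_eq_of_subset (S T : Finset Cell) (h : S ⊆ T) :
    perimeter S = ∑ c ∈ T, ∑ d ∈ nbrs c, if c ∈ S ∧ d ∉ S then 1 else 0 := by
  unfold perimeter
  rw [← Finset.sum_subset h]
  · refine Finset.sum_congr rfl fun c hc => ?_
    rw [Finset.card_filter]
    simp [hc]
  · intro c _ hc
    simp [hc]

/-- the perimeter is submodular:
`E(A ∪ B) + E(A ∩ B) ≤ E(A) + E(B)`. -/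
theorem perimeter_submodular (A B : Finset Cell) :
    perimeter (A ∪ B) + perimeter (A ∩ B) ≤ perimeter A + perimeter B := by
  rw [perimeter_eq_of_subset (A ∪ B) (A ∪ B) subset_rfl,
    perimeter_eq_of_subset (A ∩ B) (A ∪ B) (Finset.inter_subset_left.trans Finset.subset_union_left),
    perimeter_eq_of_subset A (A ∪ B) Finset.subset_union_left,
    perimeter_eq_of_subset B (A ∪ B) Finset.subset_union_right]
  simp only [← Finset.sum_add_distrib]
  refine Finset.sum_le_sum fun c _ => Finset.sum_le_sum fun d _ => ?_
  by_cases h1 : c ∈ A <;> by_cases h2 : c ∈ B <;> by_cases h3 : d ∈ A <;>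
    by_cases h4 : d ∈ B <;> simp [h1, h2, h3, h4]
end

section
/- Let P be a simple grid polygon with perimeter E(P). For any two cells s, t ∈ P there exists a walk in P from s to t of length at most E(P)/2 − 2. -/
def HE (P : Finset Cell) : Finset Cell := P.filter (fun c => (c.1 + 1, c.2) ∈ P)
def VE (P : Finset Cell) : Finset Cell := P.filter (fun c => (c.1, c.2 + 1) ∈ P)
def SQ (P : Finset Cell) : Finset Cell :=
  P.filter (fun c => (c.1 + 1, c.2) ∈ P ∧ (c.1, c.2 + 1) ∈ P ∧ (c.1 + 1, c.2 + 1) ∈ P)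

def Reach (P : Finset Cell) (n : ℕ) (c d : Cell) : Prop :=
  ∃ w : ℕ → Cell, w 0 = c ∧ w n = d ∧ IsWalk P w n

theorem Reach.trans {P : Finset Cell} {m n : ℕ} {a b c : Cell} (h1 : Reach P m a b)
    (h2 : Reach P n b c) : Reach P (m + n) a c := by
  obtain ⟨u, u0, um, hu, hu'⟩ := h1
  obtain ⟨v, v0, vn, hv, hv'⟩ := h2
  refine ⟨fun i => if i ≤ m then u i else v (i - m), by simp [u0], ?_, ?_, ?_⟩
  · by_cases h : n = 0
    · subst h; simp [um, ← vn, v0]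
    · simp [h, vn]
  · intro i hi
    dsimp only
    split_ifs with h
    · exact hu i h
    · exact hv _ (by omega)
  · intro i hi
    dsimp only
    by_cases h : i + 1 ≤ m
    · rw [if_pos (by omega), if_pos h]; exact hu' i (by omega)
    · rw [if_neg h]
      by_cases h' : i ≤ m
      · have : i = m := by omega
        subst this
        rw [if_pos le_rfl, um, ← v0]
        have := hv' 0 (by omega)
        simpa using this
      · rw [if_neg h']
        have := hv' (i - m) (by omega)
        rwa [show i - m + 1 = i + 1 - m by omega] at this

theorem Reach.refl {P : Finset Cell} {a : Cell} (h : a ∈ P) : Reach P 0 a a :=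
  ⟨fun _ => a, rfl, rfl, fun _ _ => h, fun i hi => by omega⟩

theorem Reach.step {P : Finset Cell} {a b : Cell} (ha : a ∈ P) (hb : b ∈ P) (h : EdgeAdj a b) :
    Reach P 1 a b := by
  refine ⟨fun i => if i = 0 then a else b, by simp, by simp, ?_, ?_⟩
  · intro i _; dsimp only; split_ifs <;> assumption
  · intro i hi
    have : i = 0 := by omega
    subst this; simpa using h

theorem IsWalk.sub {P : Finset Cell} {w : ℕ → Cell} {n i j : ℕ} (h : IsWalk P w n) (hij : i ≤ j)
    (hj : j ≤ n) : Reach P (j - i) (w i) (w j) := by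
  refine ⟨fun k => w (i + k), rfl, by simp [hij], ?_, ?_⟩
  · intro k hk; exact h.1 _ (by omega)
  · intro k hk; exact h.2 _ (by omega)

def man (c d : Cell) : ℕ := (c.1 - d.1).natAbs + (c.2 - d.2).natAbs

theorem man_le {P : Finset Cell} {n : ℕ} {c d : Cell} (h : Reach P n c d) : man c d ≤ n := by
  obtain ⟨w, rfl, rfl, _, h⟩ := h
  induction n with
  | zero => simp [man]
  | succ k ih =>
    have h1 := ih (fun i hi => ‹∀ i ≤ k + 1, w i ∈ P› i (by omega)) (fun i hi => h i (by omega))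
    have h2 := h k (by omega)
    simp only [man, EdgeAdj] at *
    omega

theorem reach_box {P : Finset Cell} (m : ℕ) : ∀ c d : Cell, man c d = m →
    (∀ x y : ℤ, min c.1 d.1 ≤ x → x ≤ max c.1 d.1 → min c.2 d.2 ≤ y → y ≤ max c.2 d.2 →
      (x, y) ∈ P) → Reach P m c d := by
  induction m with
  | zero =>
    rintro ⟨a, b⟩ ⟨a', b'⟩ hm h
    simp only [man] at *
    obtain rfl : a = a' := by omega
    obtain rfl : b = b' := by omega
    exact Reach.refl (h a b (by simp) (by simp) (by simp) (by simp))
  | succ k ih =>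
    rintro ⟨a, b⟩ ⟨a', b'⟩ hm h
    simp only [man] at *
    have key : ∃ p q : ℤ, (a - p).natAbs + (b - q).natAbs = 1 ∧
        (p - a').natAbs + (q - b').natAbs = k ∧ min a a' ≤ p ∧ p ≤ max a a' ∧
        min b b' ≤ q ∧ q ≤ max b b' := by
      rcases lt_trichotomy a a' with h1 | h1 | h1
      · exact ⟨a + 1, b, by omega⟩
      · rcases lt_trichotomy b b' with h2 | h2 | h2
        · exact ⟨a, b + 1, by omega⟩
        · omega
        · exact ⟨a, b - 1, by omega⟩
      · exact ⟨a - 1, b, by omega⟩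
    obtain ⟨p, q, h1, h2, h3, h4, h5, h6⟩ := key
    have hs : Reach P 1 (a, b) (p, q) :=
      Reach.step (h a b (by omega) (by omega) (by omega) (by omega)) (h p q h3 h4 h5 h6) h1
    have := hs.trans (ih (p, q) (a', b') h2 (fun x y hx hx' hy hy' =>
      h x y (by dsimp only at *; omega) (by dsimp only at *; omega) (by dsimp only at *; omega)
        (by dsimp only at *; omega)))
    rwa [add_comm] at this

theorem exists_bound (P : Finset Cell) :
    ∃ N : ℤ, ∀ c ∈ P, -N < c.1 ∧ c.1 < N ∧ -N < c.2 ∧ c.2 < N := by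
  refine ⟨∑ c ∈ P, (|c.1| + |c.2|) + 1, fun c hc => ?_⟩
  have := Finset.single_le_sum (f := fun c : Cell => |c.1| + |c.2|)
    (fun i _ => by positivity) hc
  have h1 := abs_le.1 (le_refl |c.1|)
  have h2 := abs_le.1 (le_refl |c.2|)
  have h3 := abs_nonneg c.1
  have h4 := abs_nonneg c.2
  refine ⟨?_, ?_, ?_, ?_⟩ <;> linarith [h1.1, h1.2, h2.1, h2.2]

theorem run_end (S : ℤ → Prop) (N : ℤ) (hN : ∀ y, S y → y < N) (y0 : ℤ) (h0 : S y0) :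
    ∃ r, y0 ≤ r ∧ (∀ y, y0 ≤ y → y ≤ r → S y) ∧ ¬ S (r + 1) := by
  by_contra hcon
  push Not at hcon
  have : ∀ k : ℕ, ∀ y, y0 ≤ y → y ≤ y0 + k → S y := by
    intro k
    induction k with
    | zero => intro y h1 h2; obtain rfl : y = y0 := by push_cast at h2; omega
              exact h0
    | succ k ih =>
      intro y h1 h2
      by_cases h : y ≤ y0 + k
      · exact ih y h1 h
      · have := hcon (y0 + k) (by omega) ih
        obtain rfl : y = y0 + k + 1 := by push_cast at h2; omega
        exact this
  have := hN _ (this (N - y0).toNat (y0 + (N - y0).toNat) (by omega) le_rfl)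
  omega

def RunRep (P : Finset Cell) (c d : Cell) : Cell ⊕ Cell → Prop
  | .inl r => c.2 = d.2 ∧ (c.1 = r.1 ∧ d.1 = r.1 + 1 ∨ d.1 = r.1 ∧ c.1 = r.1 + 1) ∧ c.2 ≤ r.2 ∧
      ∀ y, c.2 ≤ y → y ≤ r.2 → (r.1, y) ∈ P ∧ (r.1 + 1, y) ∈ P
  | .inr r => c.1 = d.1 ∧ (c.2 = r.2 ∧ d.2 = r.2 + 1 ∨ d.2 = r.2 ∧ c.2 = r.2 + 1) ∧ c.1 ≤ r.1 ∧
      ∀ x, c.1 ≤ x → x ≤ r.1 → (x, r.2) ∈ P ∧ (x, r.2 + 1) ∈ P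

theorem exists_rep (P : Finset Cell) (c d : Cell) (hc : c ∈ P) (hd : d ∈ P) (h : EdgeAdj c d) :
    ∃ r ∈ (HE P \ SQ P).disjSum (VE P \ SQ P), RunRep P c d r := by
  obtain ⟨N, hN⟩ := exists_bound P
  obtain ⟨a, b⟩ := c
  obtain ⟨a', b'⟩ := d
  simp only [EdgeAdj] at h
  by_cases hb : b = b'
  · subst hb
    obtain ⟨x, hx⟩ : ∃ x, (a = x ∧ a' = x + 1 ∨ a' = x ∧ a = x + 1) := by
      rcases lt_or_ge a a' with h1 | h1
      · exact ⟨a, by omega⟩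
      · exact ⟨a', by omega⟩
    obtain ⟨r, h1, h2, h3⟩ := run_end (fun y => (x, y) ∈ P ∧ (x + 1, y) ∈ P) N
      (fun y hy => (hN _ hy.1).2.2.2) b
      (by rcases hx with ⟨rfl, rfl⟩ | ⟨rfl, rfl⟩ <;> simp [hc, hd])
    refine ⟨.inl (x, r), ?_, rfl, hx, h1, h2⟩
    have := h2 r h1 le_rfl
    simp only [Finset.inl_mem_disjSum, Finset.mem_sdiff, HE, SQ, Finset.mem_filter]
    tauto
  · obtain rfl : a = a' := by omega
    obtain ⟨x, hx⟩ : ∃ x, (b = x ∧ b' = x + 1 ∨ b' = x ∧ b = x + 1) := by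
      rcases lt_or_ge b b' with h1 | h1
      · exact ⟨b, by omega⟩
      · exact ⟨b', by omega⟩
    obtain ⟨r, h1, h2, h3⟩ := run_end (fun y => (y, x) ∈ P ∧ (y, x + 1) ∈ P) N
      (fun y hy => (hN _ hy.1).2.1) a
      (by rcases hx with ⟨rfl, rfl⟩ | ⟨rfl, rfl⟩ <;> simp [hc, hd])
    refine ⟨.inr (r, x), ?_, rfl, hx, h1, h2⟩
    have := h2 r h1 le_rfl
    simp only [Finset.inr_mem_disjSum, Finset.mem_sdiff, VE, SQ, Finset.mem_filter]
    tauto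

theorem rep_box {P : Finset Cell} {c d c' d' : Cell} {r : Cell ⊕ Cell} (h : RunRep P c d r)
    (h' : RunRep P c' d' r) : Reach P (man c d') c d' ∧ man c d' ≤ man d c' := by
  obtain ⟨c1, c2⟩ := c
  obtain ⟨d1, d2⟩ := d
  obtain ⟨c1', c2'⟩ := c'
  obtain ⟨d1', d2'⟩ := d'
  rcases r with ⟨r1, r2⟩ | ⟨r1, r2⟩ <;> simp only [RunRep] at h h' <;>
    obtain ⟨h1, h2, h3, h4⟩ := h <;> obtain ⟨h1', h2', h3', h4'⟩ := h'
  · refine ⟨reach_box _ _ _ rfl ?_, by simp only [man]; omega⟩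
    intro x y hx hx' hy hy'
    dsimp only at hx hx' hy hy'
    have hy2 : (r1, y) ∈ P ∧ (r1 + 1, y) ∈ P := by
      by_cases hh : c2 ≤ y
      · exact h4 y hh (by omega)
      · exact h4' y (by omega) (by omega)
    by_cases hh : x = r1
    · rw [hh]; exact hy2.1
    · obtain rfl : x = r1 + 1 := by omega
      exact hy2.2
  · refine ⟨reach_box _ _ _ rfl ?_, by simp only [man]; omega⟩
    intro x y hx hx' hy hy'
    dsimp only at hx hx' hy hy'
    have hy2 : (x, r2) ∈ P ∧ (x, r2 + 1) ∈ P := by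
      by_cases hh : c1 ≤ x
      · exact h4 x hh (by omega)
      · exact h4' x (by omega) (by omega)
    by_cases hh : y = r2
    · rw [hh]; exact hy2.1
    · obtain rfl : y = r2 + 1 := by omega
      exact hy2.2

theorem geodesic_bound (P : Finset Cell) (s t : Cell) (n : ℕ) (hn : Reach P n s t)
    (hmin : ∀ m, Reach P m s t → n ≤ m) :
    n + 2 * (SQ P).card ≤ (HE P).card + (VE P).card := by
  obtain ⟨w, w0, wn, hw⟩ := hn
  have hex : ∀ i : ℕ, ∃ r, i < n →
      r ∈ (HE P \ SQ P).disjSum (VE P \ SQ P) ∧ RunRep P (w i) (w (i + 1)) r := by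
    intro i
    by_cases h : i < n
    · obtain ⟨r, h1, h2⟩ := exists_rep P _ _ (hw.1 i h.le) (hw.1 (i + 1) h) (hw.2 i h)
      exact ⟨r, fun _ => ⟨h1, h2⟩⟩
    · exact ⟨.inl 0, fun h' => absurd h' h⟩
  choose f hf using hex
  have key : ∀ i j, i < j → j < n → f i ≠ f j := by
    intro i j hij hj he
    have h1 := (hf i (by omega)).2
    have h2 := (hf j hj).2
    rw [← he] at h2
    obtain ⟨h3, h4⟩ := rep_box h1 h2
    have h5 := man_le (hw.sub (show i + 1 ≤ j by omega) hj.le)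
    have h6 := hw.sub (Nat.zero_le i) (by omega)
    have h7 := hw.sub (show j + 1 ≤ n by omega) le_rfl
    rw [w0] at h6
    rw [wn] at h7
    have := hmin _ ((h6.trans h3).trans h7)
    omega
  have hcard : (Finset.range n).card ≤ ((HE P \ SQ P).disjSum (VE P \ SQ P)).card := by
    apply Finset.card_le_card_of_injOn f
    · intro i hi
      exact (hf i (by simpa using hi)).1
    · intro i hi j hj he
      have hi' : i < n := by simpa using hi
      have hj' : j < n := by simpa using hj
      rcases lt_trichotomy i j with h | h | h
      · exact absurd he (key i j h hj')
      · exact h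
      · exact absurd he.symm (key j i h hi')
  have hs1 : SQ P ⊆ HE P := by
    intro c; simp only [SQ, HE, Finset.mem_filter]; tauto
  have hs2 : SQ P ⊆ VE P := by
    intro c; simp only [SQ, VE, Finset.mem_filter]; tauto
  rw [Finset.card_range, Finset.card_disjSum, Finset.card_sdiff_of_subset hs1,
    Finset.card_sdiff_of_subset hs2] at hcard
  have := Finset.card_le_card hs1
  have := Finset.card_le_card hs2
  omega

theorem perimeter_eq (P : Finset Cell) :
    perimeter P + 2 * (HE P).card + 2 * (VE P).card = 4 * P.card := by
  have e1 : ∀ c ∈ P, ((nbrs c).filter (fun d => d ∉ P)).card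
      + (if (c.1 + 1, c.2) ∈ P then 1 else 0) + (if (c.1 - 1, c.2) ∈ P then 1 else 0)
      + (if (c.1, c.2 + 1) ∈ P then 1 else 0) + (if (c.1, c.2 - 1) ∈ P then 1 else 0) = 4 := by
    intro c _
    rw [Finset.card_filter, nbrs, Finset.sum_insert, Finset.sum_insert, Finset.sum_insert,
      Finset.sum_singleton]
    · split_ifs <;> simp_all
    all_goals
      simp only [Finset.mem_insert, Finset.mem_singleton, Prod.mk.injEq]
      omega
  have e2 := Finset.sum_congr rfl e1
  simp only [Finset.sum_add_distrib, ← Finset.card_filter] at e2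
  have h1 : (P.filter (fun c => (c.1 - 1, c.2) ∈ P)).card = (HE P).card := by
    apply Finset.card_bij (fun c _ => (c.1 - 1, c.2))
    · intro c hc; simp only [HE, Finset.mem_filter] at *; simpa using hc.symm
    · rintro ⟨a, b⟩ _ ⟨a', b'⟩ _ h; simpa using h
    · rintro ⟨a, b⟩ h
      refine ⟨(a + 1, b), ?_, by simp⟩
      simp only [HE, Finset.mem_filter] at *; simpa using h.symm
  have h2 : (P.filter (fun c => (c.1, c.2 - 1) ∈ P)).card = (VE P).card := by
    apply Finset.card_bij (fun c _ => (c.1, c.2 - 1))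
    · intro c hc; simp only [VE, Finset.mem_filter] at *; simpa using hc.symm
    · rintro ⟨a, b⟩ _ ⟨a', b'⟩ _ h; simpa using h
    · rintro ⟨a, b⟩ h
      refine ⟨(a, b + 1), ?_, by simp⟩
      simp only [VE, Finset.mem_filter] at *; simpa using h.symm
  rw [h1, h2] at e2
  simp only [Finset.sum_const, smul_eq_mul] at e2
  unfold perimeter
  unfold HE VE at *
  omega

/-- extension by zero -/
def ext0 (S : Finset Cell) : (S → ℚ) →ₗ[ℚ] (Cell → ℚ) where
  toFun a := fun c => if h : c ∈ S then a ⟨c, h⟩ else 0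
  map_add' a b := by ext c; by_cases h : c ∈ S <;> simp [h]
  map_smul' r a := by ext c; by_cases h : c ∈ S <;> simp [h]

theorem ext0_not (S : Finset Cell) (a : S → ℚ) (c : Cell) (h : c ∉ S) : ext0 S a c = 0 := by
  simp [ext0, h]

theorem ext0_inj (S : Finset Cell) (a : S → ℚ) (h0 : ∀ c, ext0 S a c = 0) : a = 0 := by
  ext ⟨c, h⟩
  have := h0 c
  simpa [ext0, h] using this

/-- boundary of a chain -/
def bd (a b : Cell → ℚ) (c : Cell) : ℚ :=
  a c - a (c.1 - 1, c.2) + b c - b (c.1, c.2 - 1)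

/-- winding function, summing over the row inside `(-N, x]` -/
noncomputable def wf (N : ℤ) (b : Cell → ℚ) (c : Cell) : ℚ := ∑ x ∈ Finset.Ioc (-N) c.1, b (x, c.2)

theorem wf_step (N : ℤ) (b : Cell → ℚ) (hb : ∀ x y, x ≤ -N → b (x, y) = 0) (x y : ℤ) :
    wf N b (x, y) = wf N b (x - 1, y) + b (x, y) := by
  simp only [wf]
  by_cases h : x ≤ -N
  · rw [Finset.Ioc_eq_empty (by omega), Finset.Ioc_eq_empty (by omega), hb x y h]; simp
  · have : Finset.Ioc (-N) x = insert x (Finset.Ioc (-N) (x - 1)) := by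
      ext z; simp only [Finset.mem_Ioc, Finset.mem_insert]; omega
    rw [this, Finset.sum_insert (by simp), add_comm]

theorem wf_vert (N : ℤ) (a b : Cell → ℚ) (ha : ∀ x y, x ≤ -N → a (x, y) = 0)
    (hb : ∀ x y, x ≤ -N → b (x, y) = 0) (h : ∀ c, bd a b c = 0) (x y : ℤ) :
    wf N b (x, y) - wf N b (x, y - 1) + a (x, y) = 0 := by
  have base : ∀ x ≤ -N, wf N b (x, y) - wf N b (x, y - 1) + a (x, y) = 0 := by
    intro x hx
    simp only [wf]
    rw [Finset.Ioc_eq_empty (by omega), ha x y hx]; simp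
  rcases le_total x (-N) with hx | hx
  · exact base x hx
  · induction x, hx using Int.leInduction with
    | base => exact base _ le_rfl
    | succ x hx ih =>
      have h1 := wf_step N b hb (x + 1) y
      have h2 := wf_step N b hb (x + 1) (y - 1)
      have h3 := h (x + 1, y)
      simp only [bd, add_sub_cancel_right] at h1 h2 h3
      linarith

theorem wf_zero (P : Finset Cell) (hC : ConnectedUnder Touching ((↑P : Set Cell)ᶜ)) (N : ℤ)
    (hN : ∀ c ∈ P, -N < c.1 ∧ c.1 < N ∧ -N < c.2 ∧ c.2 < N) (a b : Cell → ℚ)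
    (ha : ∀ c, c ∉ HE P → a c = 0) (hb : ∀ c, c ∉ VE P → b c = 0)
    (h : ∀ c, bd a b c = 0) (c : Cell) (hc : c ∉ SQ P) : wf N b c = 0 := by
  have ha' : ∀ x y, x ≤ -N → a (x, y) = 0 := fun x y hx => ha _ fun hh => by
    have := (hN _ (Finset.mem_filter.1 hh).1).1
    dsimp only at this; omega
  have hb' : ∀ x y, x ≤ -N → b (x, y) = 0 := fun x y hx => hb _ fun hh => by
    have := (hN _ (Finset.mem_filter.1 hh).1).1
    dsimp only at this; omega
  have S := wf_step N b hb'
  have V := wf_vert N a b ha' hb' h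
  -- equality of the four corners of a missing cell
  have corner : ∀ x y : ℤ, (x, y) ∉ P → wf N b (x - 1, y) = wf N b (x, y) ∧
      wf N b (x, y - 1) = wf N b (x, y) ∧ wf N b (x - 1, y - 1) = wf N b (x, y) := by
    intro x y hxy
    have z1 : a (x, y) = 0 := ha _ fun hh => hxy (Finset.mem_filter.1 hh).1
    have z2 : b (x, y) = 0 := hb _ fun hh => hxy (Finset.mem_filter.1 hh).1
    have z3 : a (x - 1, y) = 0 := ha _ fun hh => hxy (by
      have := (Finset.mem_filter.1 hh).2; simpa using this)
    have s1 := S x y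
    have v1 := V x y
    have v2 := V (x - 1) y
    refine ⟨?_, ?_, ?_⟩ <;> linarith
  have touch : ∀ c d : Cell, c ∉ P → d ∉ P → Touching c d → wf N b c = wf N b d := by
    rintro ⟨x, y⟩ ⟨x', y'⟩ hc hd ⟨-, h1, h2⟩
    dsimp only at h1 h2
    have c1 := corner x y hc
    have c2 := corner x' y' hd
    obtain rfl | rfl | rfl : x' = x ∨ x' = x - 1 ∨ x' = x + 1 := by omega
    all_goals obtain rfl | rfl | rfl : y' = y ∨ y' = y - 1 ∨ y' = y + 1 := by omega
    all_goals
      try simp only [add_sub_cancel_right] at c1 c2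
      first
        | rfl
        | linarith [c1.1, c1.2.1, c1.2.2, c2.1, c2.2.1, c2.2.2]
  have conn : ∀ c d : Cell, Relation.ReflTransGen
      (fun a b => a ∈ ((↑P : Set Cell)ᶜ) ∧ b ∈ ((↑P : Set Cell)ᶜ) ∧ Touching a b) c d →
      wf N b c = wf N b d := by
    intro c d hcd
    induction hcd with
    | refl => rfl
    | tail _ h ih => exact ih.trans (touch _ _ (by simpa using h.1) (by simpa using h.2.1) h.2.2)
  have far : ((-N, 0) : Cell) ∉ P := fun hh => by
    have := (hN _ hh).1
    simp at this
  have z0 : ∀ c, c ∉ P → wf N b c = 0 := by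
    intro c hc
    rw [conn c (-N, 0) (hC c (by simpa using hc) (-N, 0) (by simpa using far))]
    simp [wf]
  obtain ⟨x, y⟩ := c
  simp only [SQ, Finset.mem_filter, not_and_or] at hc
  rcases hc with hc | hc | hc | hc
  · exact z0 _ hc
  · have := corner _ _ hc
    rw [add_sub_cancel_right] at this
    rw [this.1]; exact z0 _ hc
  · have := corner _ _ hc
    rw [add_sub_cancel_right] at this
    rw [this.2.1]; exact z0 _ hc
  · have := corner _ _ hc
    rw [add_sub_cancel_right, add_sub_cancel_right] at this
    rw [this.2.2]; exact z0 _ hc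

theorem bd_sum (P : Finset Cell) (a b : Cell → ℚ)
    (ha : ∀ c, c ∉ HE P → a c = 0) (hb : ∀ c, c ∉ VE P → b c = 0) :
    ∑ c ∈ P, bd a b c = 0 := by
  have h1 : ∑ c ∈ P, a c = ∑ c ∈ P, a (c.1 - 1, c.2) := by
    have e1 : ∑ c ∈ P, a c = ∑ c ∈ HE P, a c := by
      symm
      apply Finset.sum_subset (Finset.filter_subset _ _)
      intro c _ h; exact ha c h
    have e2 : ∑ c ∈ P, a (c.1 - 1, c.2)
        = ∑ c ∈ P.filter (fun c => (c.1 - 1, c.2) ∈ P), a (c.1 - 1, c.2) := by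
      symm
      apply Finset.sum_subset (Finset.filter_subset _ _)
      intro c hc h
      apply ha
      intro hh
      exact h (Finset.mem_filter.2 ⟨hc, (Finset.mem_filter.1 hh).1⟩)
    rw [e1, e2]
    apply Finset.sum_nbij' (fun c => (c.1 + 1, c.2)) (fun c => (c.1 - 1, c.2))
    · intro c hc; simp only [HE, Finset.mem_filter] at *; simpa using hc.symm
    · intro c hc; simp only [HE, Finset.mem_filter] at *; simpa using hc.symm
    · intro c hc; simp
    · intro c hc; simp
    · intro c hc; simp
  have h2 : ∑ c ∈ P, b c = ∑ c ∈ P, b (c.1, c.2 - 1) := by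
    have e1 : ∑ c ∈ P, b c = ∑ c ∈ VE P, b c := by
      symm
      apply Finset.sum_subset (Finset.filter_subset _ _)
      intro c _ h; exact hb c h
    have e2 : ∑ c ∈ P, b (c.1, c.2 - 1)
        = ∑ c ∈ P.filter (fun c => (c.1, c.2 - 1) ∈ P), b (c.1, c.2 - 1) := by
      symm
      apply Finset.sum_subset (Finset.filter_subset _ _)
      intro c hc h
      apply hb
      intro hh
      exact h (Finset.mem_filter.2 ⟨hc, (Finset.mem_filter.1 hh).1⟩)
    rw [e1, e2]
    apply Finset.sum_nbij' (fun c => (c.1, c.2 + 1)) (fun c => (c.1, c.2 - 1))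
    · intro c hc; simp only [VE, Finset.mem_filter] at *; simpa using hc.symm
    · intro c hc; simp only [VE, Finset.mem_filter] at *; simpa using hc.symm
    · intro c hc; simp
    · intro c hc; simp
    · intro c hc; simp
  simp only [bd, Finset.sum_sub_distrib, Finset.sum_add_distrib]
  linarith

/-- the linear map used in the Euler inequality -/
noncomputable def Psi (P Q : Finset Cell) (N : ℤ) :
    ((HE P → ℚ) × (VE P → ℚ)) →ₗ[ℚ] ((Q → ℚ) × (SQ P → ℚ)) where
  toFun z := (fun c => bd (ext0 _ z.1) (ext0 _ z.2) c, fun c => wf N (ext0 _ z.2) c)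
  map_add' z z' := by
    ext c
    · simp only [Prod.fst_add, Prod.snd_add, map_add, bd, Pi.add_apply]; ring
    · simp only [Prod.snd_add, map_add, wf, Pi.add_apply, Finset.sum_add_distrib]
  map_smul' r z := by
    ext c
    · simp only [Prod.smul_fst, Prod.smul_snd, map_smul, bd, Pi.smul_apply, smul_eq_mul,
        RingHom.id_apply]; ring
    · simp only [Prod.smul_snd, map_smul, wf, Pi.smul_apply, smul_eq_mul, Finset.mul_sum,
        RingHom.id_apply]

theorem euler (P : Finset Cell) (hne : P.Nonempty)
    (hC : ConnectedUnder Touching ((↑P : Set Cell)ᶜ)) :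
    (HE P).card + (VE P).card + 1 ≤ P.card + (SQ P).card := by
  obtain ⟨N, hN⟩ := exists_bound P
  obtain ⟨p, hp⟩ := hne
  have inj : Function.Injective (Psi P (P.erase p) N) := by
    rw [← LinearMap.ker_eq_bot, LinearMap.ker_eq_bot']
    rintro ⟨a, b⟩ hz
    have hz1 : ∀ c ∈ P.erase p, bd (ext0 _ a) (ext0 _ b) c = 0 := fun c hc =>
      congrFun (congrArg Prod.fst hz) ⟨c, hc⟩
    have hz2 : ∀ c ∈ SQ P, wf N (ext0 _ b) c = 0 := fun c hc =>
      congrFun (congrArg Prod.snd hz) ⟨c, hc⟩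
    have ha := ext0_not _ a
    have hb := ext0_not _ b
    generalize hA : ext0 _ a = A at *
    generalize hB : ext0 _ b = B at *
    have hsum := bd_sum P A B ha hb
    rw [← Finset.add_sum_erase _ _ hp, Finset.sum_eq_zero hz1, add_zero] at hsum
    have hall : ∀ c, bd A B c = 0 := by
      intro c
      by_cases hc : c ∈ P
      · by_cases hcp : c = p
        · rw [hcp]; exact hsum
        · exact hz1 c (Finset.mem_erase.2 ⟨hcp, hc⟩)
      · have z1 : A c = 0 := ha _ fun hh => hc (Finset.mem_filter.1 hh).1
        have z2 : B c = 0 := hb _ fun hh => hc (Finset.mem_filter.1 hh).1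
        have z3 : A (c.1 - 1, c.2) = 0 := ha _ fun hh => hc (by
          have := (Finset.mem_filter.1 hh).2; simpa using this)
        have z4 : B (c.1, c.2 - 1) = 0 := hb _ fun hh => hc (by
          have := (Finset.mem_filter.1 hh).2; simpa using this)
        simp [bd, z1, z2, z3, z4]
    have hw : ∀ c, wf N B c = 0 := by
      intro c
      by_cases hc : c ∈ SQ P
      · exact hz2 c hc
      · exact wf_zero P hC N hN A B ha hb hall c hc
    have ha' : ∀ x y, x ≤ -N → A (x, y) = 0 := fun x y hx => ha _ fun hh => by
      have := (hN _ (Finset.mem_filter.1 hh).1).1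
      dsimp only at this; omega
    have hb' : ∀ x y, x ≤ -N → B (x, y) = 0 := fun x y hx => hb _ fun hh => by
      have := (hN _ (Finset.mem_filter.1 hh).1).1
      dsimp only at this; omega
    have hA0 : ∀ c, A c = 0 := by
      rintro ⟨x, y⟩
      have := wf_vert N A B ha' hb' hall x y
      simpa [hw] using this
    have hB0 : ∀ c, B c = 0 := by
      rintro ⟨x, y⟩
      have := wf_step N B hb' x y
      simpa [hw] using this.symm
    have ra : a = 0 := ext0_inj _ a (by rw [hA]; exact hA0)
    have rb : b = 0 := ext0_inj _ b (by rw [hB]; exact hB0)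
    rw [ra, rb]; rfl
  have := LinearMap.finrank_le_finrank_of_injective inj
  simp only [Module.finrank_prod, Module.finrank_fintype_fun_eq_card, Fintype.card_coe,
    Finset.card_erase_of_mem hp] at this
  have := Finset.card_pos.2 ⟨p, hp⟩
  omega

theorem reach_of_conn (P : Finset Cell) (s t : Cell) (hs : s ∈ P)
    (h : Relation.ReflTransGen (fun a b => a ∈ (↑P : Set Cell) ∧ b ∈ (↑P : Set Cell) ∧
      EdgeAdj a b) s t) : ∃ n, Reach P n s t := by
  induction h with
  | refl => exact ⟨0, Reach.refl hs⟩
  | tail _ h ih =>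
    obtain ⟨n, hn⟩ := ih
    exact ⟨n + 1, hn.trans (Reach.step (by simpa using h.1) (by simpa using h.2.1) h.2.2)⟩

/-- in a simple grid polygon, any two cells are joined by a walk
of length at most `E(P)/2 - 2`. -/
theorem walk_length_le_half_perimeter (P : Finset Cell) (hP : SimplePolygon P)
    (s t : Cell) (hs : s ∈ P) (ht : t ∈ P) :
    ∃ (w : ℕ → Cell) (n : ℕ), w 0 = s ∧ w n = t ∧ IsWalk P w n ∧
      (n : ℝ) ≤ (perimeter P : ℝ) / 2 - 2 := by
  classical
  have hex := reach_of_conn P s t hs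
    (hP.1.2 s (Finset.mem_coe.2 hs) t (Finset.mem_coe.2 ht))
  have hn := Nat.find_spec hex
  have hb := geodesic_bound P s t (Nat.find hex) hn (fun m hm => Nat.find_min' hex hm)
  obtain ⟨w, w0, wn, hw⟩ := hn
  refine ⟨w, Nat.find hex, w0, wn, hw, ?_⟩
  have h1 := perimeter_eq P
  have h2 := euler P hP.1.1 hP.2
  have h3 : 2 * Nat.find hex + 4 ≤ perimeter P := by omega
  have h4 : (2 : ℝ) * (Nat.find hex : ℝ) + 4 ≤ perimeter P := by exact_mod_cast h3
  linarith
end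

section
/- A simple grid polygon P with C cells satisfies E(P) = 2C + 2 if and only if P contains no 2×2 square of free cells, i.e., there is no cell (x,y) with all four cells (x,y), (x+1,y), (x,y+1), (x+1,y+1) belonging to P. Moreover, E(P) ≤ 2C + 2 always holds, so 2C + 2 is the maximum possible perimeter. -/
section Helpers

theorem pot_main (P : Finset Cell) (hC : ConnectedUnder Touching ((↑P : Set Cell)ᶜ))
    (h v : ℤ → ℤ → ZMod 2)
    (hh : ∀ x y, h x y ≠ 0 → ((x, y) : Cell) ∈ P ∧ ((x + 1, y) : Cell) ∈ P)
    (hv : ∀ x y, v x y ≠ 0 → ((x, y) : Cell) ∈ P ∧ ((x, y + 1) : Cell) ∈ P)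
    (hev : ∀ x y, h x y + h (x - 1) y + v x y + v x (y - 1) = 0)
    (hsq : ¬ ∃ x y : ℤ, ((x, y) : Cell) ∈ P ∧ ((x + 1, y) : Cell) ∈ P ∧
        ((x, y + 1) : Cell) ∈ P ∧ ((x + 1, y + 1) : Cell) ∈ P) :
    (∀ x y, h x y = 0) ∧ (∀ x y, v x y = 0) := by
  obtain ⟨L, hL⟩ : ∃ L : ℤ, ∀ c ∈ P, L < c.2 := by
    obtain ⟨L, hL⟩ := (P.image Prod.snd).bddBelow
    refine ⟨L - 1, fun c hc => ?_⟩
    have := hL (Finset.mem_coe.2 (Finset.mem_image_of_mem Prod.snd hc))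
    omega
  have h0 : ∀ x y, y ≤ L → h x y = 0 := fun x y hy => by
    by_contra hne
    have := hL _ (hh x y hne).1
    simp only at this; omega
  have v0 : ∀ x y, y ≤ L → v x y = 0 := fun x y hy => by
    by_contra hne
    have := hL _ (hv x y hne).1
    simp only at this; omega
  let f : ℤ → ℤ → ZMod 2 := fun x y => ∑ k ∈ Finset.Ioc L y, h x k
  have f0 : ∀ x y, y ≤ L → f x y = 0 := fun x y hy => by
    simp only [f]; rw [Finset.Ioc_eq_empty (by omega)]; simp
  have fh : ∀ x y, f x y = f x (y - 1) + h x y := fun x y => by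
    rcases le_or_gt y L with hy | hy
    · rw [f0 x y hy, f0 x (y - 1) (by omega), h0 x y hy]; simp
    · have : Finset.Ioc L y = insert y (Finset.Ioc L (y - 1)) := by
        ext k; simp only [Finset.mem_Ioc, Finset.mem_insert]; omega
      simp only [f]
      rw [this, Finset.sum_insert (by simp), add_comm]
  have fv' : ∀ x, ∀ n : ℕ, f x (L + n) = f (x - 1) (L + n) + v x (L + n) := fun x n => by
    induction n with
    | zero => simp [f0 x L le_rfl, f0 (x - 1) L le_rfl, v0 x L le_rfl]
    | succ n ih =>
      have e1 := fh x (L + (n + 1 : ℕ))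
      have e2 := fh (x - 1) (L + (n + 1 : ℕ))
      have e3 := hev x (L + (n + 1 : ℕ))
      have e : L + ((n + 1 : ℕ) : ℤ) - 1 = L + n := by push_cast; ring
      rw [e] at e1 e2 e3
      rw [e1, e2, ih]
      have two : (2 : ZMod 2) = 0 := rfl
      linear_combination e3 - (h (x - 1) (L + (n + 1 : ℕ)) + v x (L + (n + 1 : ℕ))) * two
  have fv : ∀ x y, f x y = f (x - 1) y + v x y := fun x y => by
    rcases le_or_gt y L with hy | hy
    · simp [f0 x y hy, f0 (x - 1) y hy, v0 x y hy]
    · have := fv' x (y - L).toNat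
      rwa [show L + ((y - L).toNat : ℤ) = y by omega] at this
  have loc : ∀ x y, ((x, y) : Cell) ∉ P → f (x - 1) y = f x y ∧ f x (y - 1) = f x y ∧
      f (x - 1) (y - 1) = f x y := fun x y hxy => by
    have a1 : h x y = 0 := by
      by_contra hne; exact hxy (hh x y hne).1
    have a2 : v x y = 0 := by
      by_contra hne; exact hxy (hv x y hne).1
    have a3 : h (x - 1) y = 0 := by
      by_contra hne; exact hxy (by simpa using (hh (x - 1) y hne).2)
    have b1 := fh x y
    have b2 := fv x y
    have b3 := fh (x - 1) y
    rw [a1, add_zero] at b1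
    rw [a2, add_zero] at b2
    rw [a3, add_zero] at b3
    exact ⟨b2.symm, b1.symm, b3.symm.trans b2.symm⟩
  have touch : ∀ x y x' y', ((x, y) : Cell) ∉ P → ((x', y') : Cell) ∉ P →
      Touching (x, y) (x', y') → f x y = f x' y' := fun x y x' y' hp hp' ht => by
    obtain ⟨-, t1, t2⟩ := ht
    simp only at t1 t2
    obtain ⟨a1, a2, a3⟩ := loc x y hp
    obtain ⟨b1, b2, b3⟩ := loc x' y' hp'
    have c1 : x' = x ∨ x' = x - 1 ∨ x = x' - 1 := by omega
    have c2 : y' = y ∨ y' = y - 1 ∨ y = y' - 1 := by omega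
    rcases c1 with c1 | c1 | c1 <;> rcases c2 with c2 | c2 | c2 <;> subst c1 <;> subst c2 <;>
      clear hC hh hv hev hsq hL h0 v0 f0 fh fv' fv loc hp hp' t1 t2 <;>
      clear_value f <;> grind only
  have base : ((0, L) : Cell) ∉ P := fun hm => by
    have := hL _ hm
    simp at this
  have out : ∀ c : Cell, c ∉ P → f c.1 c.2 = 0 := fun c hc => by
    have := hC (0, L) (by simpa using base) c (by simpa using hc)
    induction this with
    | refl => exact f0 _ _ le_rfl
    | tail _ hs ih =>
      obtain ⟨s1, s2, s3⟩ := hs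
      have s1 := (by simpa using s1 : _ ∉ P)
      rw [← touch _ _ _ _ s1 hc s3]
      exact ih s1
  have fz : ∀ x y, f x y = 0 := fun x y => by
    by_contra hne
    apply hsq
    refine ⟨x, y, ?_, ?_, ?_, ?_⟩ <;> by_contra hm <;> apply hne
    · exact out _ hm
    · have := (loc _ _ hm).1
      rw [out _ hm] at this; simpa using this
    · have := (loc _ _ hm).2.1
      rw [out _ hm] at this; simpa using this
    · have := (loc _ _ hm).2.2
      rw [out _ hm] at this; simpa using this
  constructor
  · intro x y
    have := fh x y
    simpa [fz] using this.symm
  · intro x y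
    have := fv x y
    simpa [fz] using this.symm

theorem mem_nbrs {c d : Cell} : d ∈ nbrs c ↔ EdgeAdj c d := by
  obtain ⟨a, b⟩ := c
  obtain ⟨x, y⟩ := d
  simp only [nbrs, EdgeAdj, Finset.mem_insert, Finset.mem_singleton, Prod.mk.injEq]
  omega

theorem card_nbrs (c : Cell) : (nbrs c).card = 4 := by
  unfold nbrs
  rw [Finset.card_insert_of_notMem, Finset.card_insert_of_notMem, Finset.card_insert_of_notMem,
    Finset.card_singleton] <;>
  simp only [Finset.mem_insert, Finset.mem_singleton, Prod.mk.injEq] <;> omega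

/-- The adjacency graph. -/
def cellG (P : Finset Cell) : SimpleGraph Cell where
  Adj a b := a ∈ P ∧ b ∈ P ∧ EdgeAdj a b
  symm := ⟨fun a b h => ⟨h.2.1, h.1, by have := h.2.2; unfold EdgeAdj at *; omega⟩⟩
  loopless := ⟨fun a h => by have := h.2.2; simp [EdgeAdj] at this⟩

/-- The adjacency graph on the cells. -/
def polyG (P : Finset Cell) : SimpleGraph P := (cellG P).comap (fun x => x.1)

theorem acyclic_of (P : Finset Cell) (hC : ConnectedUnder Touching ((↑P : Set Cell)ᶜ))
    (hsq : ¬ ∃ x y : ℤ, ((x, y) : Cell) ∈ P ∧ ((x + 1, y) : Cell) ∈ P ∧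
        ((x, y + 1) : Cell) ∈ P ∧ ((x + 1, y + 1) : Cell) ∈ P) : (cellG P).IsAcyclic := by
  classical
  intro u p hp
  have hadj : ∀ a b, s(a, b) ∈ p.edges → a ∈ P ∧ b ∈ P ∧ EdgeAdj a b := fun a b hab =>
    p.adj_of_mem_edges hab
  let h : ℤ → ℤ → ZMod 2 := fun x y => if s(((x, y) : Cell), (x + 1, y)) ∈ p.edges then 1 else 0
  let v : ℤ → ℤ → ZMod 2 := fun x y => if s(((x, y) : Cell), (x, y + 1)) ∈ p.edges then 1 else 0
  have key := pot_main P hC h v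
    (fun x y hne => by
      have : s(((x, y) : Cell), (x + 1, y)) ∈ p.edges := by
        by_contra hc; simp [h, hc] at hne
      exact ⟨(hadj _ _ this).1, (hadj _ _ this).2.1⟩)
    (fun x y hne => by
      have : s(((x, y) : Cell), (x, y + 1)) ∈ p.edges := by
        by_contra hc; simp [v, hc] at hne
      exact ⟨(hadj _ _ this).1, (hadj _ _ this).2.1⟩)
    (fun x y => by
      have ev := (hp.isTrail.even_countP_edges_iff (x, y)).2 (by simp)
      rw [List.countP_eq_length_filter,
        ← List.toFinset_card_of_nodup (hp.isTrail.edges_nodup.filter _)] at ev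
      have e : (p.edges.filter (fun e => ((x, y) : Cell) ∈ e)).toFinset =
          ((nbrs (x, y)).filter (fun d => s(((x, y) : Cell), d) ∈ p.edges)).image
            (fun d => s(((x, y) : Cell), d)) := by
        ext e
        simp only [List.mem_toFinset, List.mem_filter, Finset.mem_image, Finset.mem_filter,
          decide_eq_true_eq, mem_nbrs]
        constructor
        · rintro ⟨h1, h2⟩
          obtain ⟨d, rfl⟩ := h2
          exact ⟨d, ⟨(hadj _ _ h1).2.2, h1⟩, rfl⟩
        · rintro ⟨d, ⟨_, h2⟩, rfl⟩
          exact ⟨h2, by simp⟩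
      rw [e, Finset.card_image_of_injective _ (fun a b hab => Sym2.congr_right.1 hab),
        Finset.card_filter] at ev
      have ev2 := (ZMod.natCast_eq_zero_iff_even).2 ev
      have n1 : ((x + 1, y) : Cell) ∉ ({(x - 1, y), (x, y + 1), (x, y - 1)} : Finset Cell) := by
        simp only [Finset.mem_insert, Finset.mem_singleton, Prod.mk.injEq]; omega
      have n2 : ((x - 1, y) : Cell) ∉ ({(x, y + 1), (x, y - 1)} : Finset Cell) := by
        simp only [Finset.mem_insert, Finset.mem_singleton, Prod.mk.injEq]; omega
      have n3 : ((x, y + 1) : Cell) ∉ ({(x, y - 1)} : Finset Cell) := by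
        simp only [Finset.mem_singleton, Prod.mk.injEq]; omega
      unfold nbrs at ev2
      rw [Finset.sum_insert n1, Finset.sum_insert n2, Finset.sum_insert n3,
        Finset.sum_singleton] at ev2
      push_cast at ev2
      simp only [h, v, sub_add_cancel]
      rw [Sym2.eq_swap (a := ((x - 1, y) : Cell)), Sym2.eq_swap (a := ((x, y - 1) : Cell))]
      linear_combination ev2)
    hsq
  obtain ⟨kh, kv⟩ := key
  have kh' : ∀ x y : ℤ, s(((x, y) : Cell), (x + 1, y)) ∉ p.edges := fun x y hm => by
    have := kh x y; simp [h, hm] at this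
  have kv' : ∀ x y : ℤ, s(((x, y) : Cell), (x, y + 1)) ∉ p.edges := fun x y hm => by
    have := kv x y; simp [v, hm] at this
  have none : ∀ e, e ∉ p.edges := fun e => by
    induction e with
    | _ a b =>
    intro hm
    have hE := (hadj a b hm).2.2
    rw [← mem_nbrs] at hE
    obtain ⟨x, y⟩ := a
    simp only [nbrs, Finset.mem_insert, Finset.mem_singleton] at hE
    rcases hE with rfl | rfl | rfl | rfl
    · exact kh' _ _ hm
    · rw [Sym2.eq_swap] at hm
      exact kh' (x - 1) y (by simpa using hm)
    · exact kv' _ _ hm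
    · rw [Sym2.eq_swap] at hm
      exact kv' x (y - 1) (by simpa using hm)
  have l3 := hp.three_le_length
  rw [← p.length_edges, List.eq_nil_iff_forall_not_mem.2 none] at l3
  simp at l3

theorem polyG_connected (P : Finset Cell) (hP : GridPolygon P) : (polyG P).Connected := by
  obtain ⟨⟨a, ha⟩, hc⟩ := hP
  have : Nonempty P := ⟨⟨a, ha⟩⟩
  refine ⟨fun c d => ?_⟩
  have key : ∀ d : Cell, Relation.ReflTransGen
      (fun a b => a ∈ (↑P : Set Cell) ∧ b ∈ (↑P : Set Cell) ∧ EdgeAdj a b) c.1 d →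
      ∀ hd : d ∈ P, (polyG P).Reachable c ⟨d, hd⟩ := by
    intro d h
    induction h with
    | refl => intro hd; exact SimpleGraph.Reachable.refl _
    | tail _ hs ih =>
      intro hd
      obtain ⟨s1, s2, s3⟩ := hs
      refine (ih s1).trans (SimpleGraph.Adj.reachable ?_)
      exact ⟨s1, s2, s3⟩
  exact key d.1 (hc _ c.2 _ d.2) d.2

theorem perimeter_add (P : Finset Cell) :
    perimeter P + 2 * Nat.card (polyG P).edgeSet = 4 * P.card := by
  classical
  have hs := (polyG P).sum_degrees_eq_twice_card_edges
  rw [Nat.card_eq_fintype_card, ← SimpleGraph.edgeFinset_card, ← hs]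
  have hd : ∀ c : P, (polyG P).degree c = ((nbrs c.1).filter (fun d => d ∈ P)).card := fun c => by
    rw [← SimpleGraph.card_neighborFinset_eq_degree,
      ← Finset.card_map (Function.Embedding.subtype _)]
    congr 1
    ext d
    simp only [Finset.mem_map, SimpleGraph.mem_neighborFinset, Finset.mem_filter, mem_nbrs]
    constructor
    · rintro ⟨e, he, rfl⟩
      exact ⟨he.2.2, e.2⟩
    · rintro ⟨h1, h2⟩
      exact ⟨⟨d, h2⟩, ⟨c.2, h2, h1⟩, rfl⟩
  simp_rw [hd]
  rw [Finset.sum_coe_sort P (fun c => ((nbrs c).filter (fun d => d ∈ P)).card)]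
  unfold perimeter
  rw [← Finset.sum_add_distrib, Finset.sum_congr rfl (g := fun _ => 4), Finset.sum_const]
  · simp [mul_comm]
  · intro c _
    rw [add_comm, Finset.card_filter_add_card_filter_not, card_nbrs]

theorem not_acyclic_of (P : Finset Cell) (x y : ℤ) (h1 : ((x, y) : Cell) ∈ P)
    (h2 : ((x + 1, y) : Cell) ∈ P) (h3 : ((x, y + 1) : Cell) ∈ P)
    (h4 : ((x + 1, y + 1) : Cell) ∈ P) : ¬ (polyG P).IsAcyclic := by
  intro hA
  have a1 : (polyG P).Adj ⟨_, h1⟩ ⟨_, h2⟩ := ⟨h1, h2, by simp [EdgeAdj]⟩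
  have a2 : (polyG P).Adj ⟨_, h2⟩ ⟨_, h4⟩ := ⟨h2, h4, by simp [EdgeAdj]⟩
  have a3 : (polyG P).Adj ⟨_, h1⟩ ⟨_, h3⟩ := ⟨h1, h3, by simp [EdgeAdj]⟩
  have a4 : (polyG P).Adj ⟨_, h3⟩ ⟨_, h4⟩ := ⟨h3, h4, by simp [EdgeAdj]⟩
  let p := SimpleGraph.Walk.cons a1 (SimpleGraph.Walk.cons a2 SimpleGraph.Walk.nil)
  let q := SimpleGraph.Walk.cons a3 (SimpleGraph.Walk.cons a4 SimpleGraph.Walk.nil)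
  have hp : p.IsPath := by simp [p, SimpleGraph.Walk.cons_isPath_iff]
  have hq : q.IsPath := by simp [q, SimpleGraph.Walk.cons_isPath_iff]
  have := hA.path_unique ⟨p, hp⟩ ⟨q, hq⟩
  have := congrArg (fun r => r.1.support) this
  simp [p, q] at this

end Helpers

/-- a simple grid polygon satisfies `E(P) = 2C + 2` iff it contains
no 2×2 square of free cells; moreover `E(P) ≤ 2C + 2` always holds. -/
theorem perimeter_eq_max_iff_no_square (P : Finset Cell) (hP : SimplePolygon P) :
    (perimeter P = 2 * P.card + 2 ↔
      ¬ ∃ x y : ℤ, ((x, y) : Cell) ∈ P ∧ ((x + 1, y) : Cell) ∈ P ∧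
        ((x, y + 1) : Cell) ∈ P ∧ ((x + 1, y + 1) : Cell) ∈ P) ∧
    perimeter P ≤ 2 * P.card + 2 := by
  obtain ⟨hG, hC⟩ := hP
  have hconn := polyG_connected P hG
  have hper := perimeter_add P
  have hle := hconn.card_vert_le_card_edgeSet_add_one
  have hcard : Nat.card P = P.card := by simp
  rw [hcard] at hle
  have htree := (polyG P).isTree_iff_connected_and_card
  rw [hcard] at htree
  refine ⟨⟨?_, ?_⟩, by omega⟩
  · rintro he ⟨x, y, h1, h2, h3, h4⟩
    exact not_acyclic_of P x y h1 h2 h3 h4 (htree.2 ⟨hconn, by omega⟩).2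
  · intro hsq
    have hA : (polyG P).IsAcyclic :=
      (acyclic_of P hC hsq).comap ⟨fun x => x.1, fun h => h⟩ Subtype.val_injective
    have := (htree.1 ⟨hconn, hA⟩).2
    omega
end

section
/- Let P be a simple grid polygon with C ≥ 2 cells that contains no 2×2 square of free cells (no cell (x,y) with all of (x,y), (x+1,y), (x,y+1), (x+1,y+1) in P), and let s ∈ P. Then the minimum length of a closed walk in P starting and ending at s that covers P is exactly 2C − 2; in particular the exploration bound C + E/2 − 3 is attained with equality on such polygons. -/
lemma nsq_pot (v h : ℤ → ℤ → ZMod 2) (N : ℤ)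
    (hv : ∀ x y, N ≤ x → v x y = 0) (hh : ∀ x y, N ≤ x → h x y = 0)
    (hev : ∀ x y, h x y + h (x-1) y + v x y + v x (y-1) = 0) :
    ∃ f : ℤ → ℤ → ZMod 2, (∀ x y, f (x-1) y = f x y + v x y) ∧
      (∀ x y, f x y = f x (y-1) + h x y) ∧ (∀ x y, N ≤ x → f x y = 0) := by
  have h2 : ∀ a : ZMod 2, a + a = 0 := by decide
  let f : ℤ → ℤ → ZMod 2 := fun x y => ∑ k ∈ Finset.range (N - x).toNat, v (x+1+k) y
  have h0 : ∀ x y, N ≤ x → f x y = 0 := by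
    intro x y hx
    have : (N - x).toNat = 0 := by omega
    simp [f, this]
  have h1 : ∀ x y, f (x-1) y = f x y + v x y := by
    intro x y
    by_cases hx : N ≤ x - 1
    · rw [h0 _ _ hx, h0 x y (by omega), hv x y (by omega)]; rfl
    · have : (N - (x-1)).toNat = (N - x).toNat + 1 := by omega
      simp only [f, this]
      rw [Finset.sum_range_succ']
      congr 1
      · apply Finset.sum_congr rfl
        intro k _
        congr 1
        push_cast; ring
      · congr 1
        push_cast; ring
  refine ⟨f, h1, ?_, h0⟩
  intro x y
  by_cases hx : N ≤ x
  · rw [h0 _ _ hx, h0 _ _ hx, hh _ _ hx]; rfl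
  · have hx' : x ≤ N := by omega
    clear hx
    induction x, hx' using Int.leInductionDown with
    | base => rw [h0 _ _ le_rfl, h0 _ _ le_rfl, hh _ _ le_rfl]; rfl
    | pred n hn ih =>
      rw [h1, h1, ih]
      have := hev n y
      generalize f n (y-1) = a at *
      generalize h n y = b at *
      generalize h (n-1) y = c at *
      generalize v n y = d at *
      generalize v n (y-1) = e at *
      clear * - this
      revert a b c d e
      decide

lemma nsq_key (P : Finset Cell) (hP : ConnectedUnder Touching ((↑P : Set Cell)ᶜ))
    (hsq : ¬ ∃ x y : ℤ, ((x, y) : Cell) ∈ P ∧ ((x + 1, y) : Cell) ∈ P ∧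
      ((x, y + 1) : Cell) ∈ P ∧ ((x + 1, y + 1) : Cell) ∈ P)
    (v h : ℤ → ℤ → ZMod 2)
    (hv : ∀ x y, ¬ ((x,y) ∈ P ∧ (x,y+1) ∈ P) → v x y = 0)
    (hh : ∀ x y, ¬ ((x,y) ∈ P ∧ (x+1,y) ∈ P) → h x y = 0)
    (hev : ∀ x y, h x y + h (x-1) y + v x y + v x (y-1) = 0) :
    ∀ x y, v x y = 0 ∧ h x y = 0 := by
  obtain ⟨N, hN⟩ : ∃ N : ℤ, ∀ x y, N ≤ x → (x,y) ∉ P := by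
    obtain ⟨M, hM⟩ := (P.image Prod.fst).bddAbove
    refine ⟨M+1, fun x y hx hm => ?_⟩
    have : x ≤ M := hM (by simpa using ⟨y, hm⟩)
    omega
  obtain ⟨f, h1, h2, h0⟩ := nsq_pot v h N
    (fun x y hx => hv x y (fun hm => hN x y hx hm.1))
    (fun x y hx => hh x y (fun hm => hN x y hx hm.1)) hev
  have four : ∀ x y, (x,y) ∉ P → f (x-1) y = f x y ∧ f x (y-1) = f x y ∧
      f (x-1) (y-1) = f x y := by
    intro x y hc
    have a1 := hv x y (fun hm => hc hm.1)
    have a2 := hh x y (fun hm => hc hm.1)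
    have a3 := hv x (y-1) (fun hm => hc (by simpa using hm.2))
    have b1 := h1 x y
    have b2 := h2 x y
    have b3 := h1 x (y-1)
    rw [a1, add_zero] at b1
    rw [a2, add_zero] at b2
    rw [a3, add_zero] at b3
    exact ⟨b1, b2.symm, b3.trans b2.symm⟩
  have touch : ∀ c d : Cell, c ∉ P → d ∉ P → Touching c d → f c.1 c.2 = f d.1 d.2 := by
    rintro ⟨x, y⟩ ⟨x', y'⟩ hc hd ⟨_, ht1, ht2⟩
    simp only at ht1 ht2 ⊢
    obtain ⟨c1, c2, c3⟩ := four x y hc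
    obtain ⟨d1, d2, d3⟩ := four x' y' hd
    have e1 : x' = x - 1 ∨ x' = x ∨ x = x' - 1 := by omega
    have e2 : y' = y - 1 ∨ y' = y ∨ y = y' - 1 := by omega
    rcases e1 with rfl | rfl | rfl <;> rcases e2 with rfl | rfl | rfl <;>
      first | rfl | exact c1.symm | exact c2.symm | exact c3.symm | exact d1 | exact d2 | exact d3 | exact c1.symm.trans d2 | exact c2.symm.trans d1
  have zero : ∀ x y, (x,y) ∉ P → f x y = 0 := by
    intro x y hc
    have := hP (N, y) (by simpa using hN N y le_rfl) (x, y) (by simpa using hc)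
    have key : ∀ d : Cell, Relation.ReflTransGen
        (fun a b => a ∈ ((↑P : Set Cell)ᶜ) ∧ b ∈ ((↑P : Set Cell)ᶜ) ∧ Touching a b) (N, y) d →
        f d.1 d.2 = 0 := by
      intro d hd
      induction hd with
      | refl => exact h0 _ _ le_rfl
      | tail _ hb ih =>
        rw [← ih]
        exact (touch _ _ (by simpa using hb.1) (by simpa using hb.2.1) hb.2.2).symm
    exact key _ this
  have all : ∀ x y, f x y = 0 := by
    intro x y
    by_contra hne
    apply hsq
    refine ⟨x, y, ?_, ?_, ?_, ?_⟩ <;> by_contra hc <;> apply hne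
    · exact zero _ _ hc
    · have := (four _ _ hc).1
      rw [zero _ _ hc] at this; simpa using this
    · have := (four _ _ hc).2.1
      rw [zero _ _ hc] at this; simpa using this
    · have := (four _ _ hc).2.2
      rw [zero _ _ hc] at this; simpa using this
  intro x y
  have a := h1 x y
  have b := h2 x y
  simp only [all, zero_add] at a b
  exact ⟨a.symm, b.symm⟩

/-- Adjacency graph of the cells of `P`. -/
def nsqG (P : Finset Cell) : SimpleGraph Cell where
  Adj a b := a ∈ P ∧ b ∈ P ∧ EdgeAdj a b
  symm := ⟨by
    rintro a b ⟨h1, h2, h3⟩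
    refine ⟨h2, h1, ?_⟩
    unfold EdgeAdj at *
    omega⟩
  loopless := ⟨by
    rintro a ⟨_, _, h⟩
    simp [EdgeAdj] at h⟩

lemma nsq_step (x y : ℤ) (a b : Cell) (hab : EdgeAdj a b) :
    (if s(a,b) = s(((x,y):Cell),(x+1,y)) then (1 : ZMod 2) else 0)
    + (if s(a,b) = s(((x-1,y):Cell),(x-1+1,y)) then 1 else 0)
    + (if s(a,b) = s(((x,y):Cell),(x,y+1)) then 1 else 0)
    + (if s(a,b) = s(((x,y-1):Cell),(x,y-1+1)) then 1 else 0)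
    = (if a = (x,y) then 1 else 0) + (if b = (x,y) then 1 else 0) := by
  obtain ⟨p, q⟩ := a
  obtain ⟨r, t⟩ := b
  simp only [EdgeAdj] at hab
  simp only [Sym2.eq_iff, Prod.mk.injEq]
  have : (r = p + 1 ∧ t = q) ∨ (r = p - 1 ∧ t = q) ∨ (r = p ∧ t = q + 1) ∨ (r = p ∧ t = q - 1) := by
    omega
  by_cases h1 : p = x ∧ q = y <;> by_cases h2 : r = x ∧ t = y
  · omega
  all_goals
    rcases this with h | h | h | h
    all_goals
      repeat first | rw [if_pos (by omega)] | rw [if_neg (by omega)]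
      try rfl

lemma nsq_walk_parity (P : Finset Cell) (x y : ℤ) {u w : Cell} (p : (nsqG P).Walk u w) :
    (p.edges.count s(((x,y):Cell),(x+1,y)) : ZMod 2)
    + (p.edges.count s(((x-1,y):Cell),(x-1+1,y)) : ZMod 2)
    + (p.edges.count s(((x,y):Cell),(x,y+1)) : ZMod 2)
    + (p.edges.count s(((x,y-1):Cell),(x,y-1+1)) : ZMod 2)
    = (if u = (x,y) then 1 else 0) + (if w = (x,y) then 1 else 0) := by
  induction p with
  | nil =>
    have h2 : ∀ a : ZMod 2, a + a = 0 := by decide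
    simp [h2]
  | @cons a b c hab p ih =>
    have := nsq_step x y a b hab.2.2
    simp only [SimpleGraph.Walk.edges_cons, List.count_cons, Nat.cast_add, beq_iff_eq,
      Nat.cast_ite, Nat.cast_one, Nat.cast_zero]
    have h2 : ∀ a b c : ZMod 2, a + b + (b + c) = a + c := by decide
    refine Eq.trans ?_ (h2 _ (if b = (x,y) then (1 : ZMod 2) else 0) _)
    rw [← this, ← ih]
    ring

lemma nsq_even (P : Finset Cell) (hP : ConnectedUnder Touching ((↑P : Set Cell)ᶜ))
    (hsq : ¬ ∃ x y : ℤ, ((x, y) : Cell) ∈ P ∧ ((x + 1, y) : Cell) ∈ P ∧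
      ((x, y + 1) : Cell) ∈ P ∧ ((x + 1, y + 1) : Cell) ∈ P)
    {u : Cell} (p : (nsqG P).Walk u u) (e : Sym2 Cell) (he : e ∈ p.edges) :
    Even (p.edges.count e) := by
  have key := nsq_key P hP hsq (fun x y => (p.edges.count s(((x,y):Cell),(x,y+1)) : ZMod 2))
    (fun x y => (p.edges.count s(((x,y):Cell),(x+1,y)) : ZMod 2)) ?_ ?_ ?_
  · have := p.edges_subset_edgeSet he
    induction e using Sym2.ind with
    | _ a b =>
    obtain ⟨_, _, h⟩ := this
    obtain ⟨p', q⟩ := a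
    obtain ⟨r, t⟩ := b
    simp only [EdgeAdj] at h
    simp only [ZMod.natCast_eq_zero_iff_even] at key
    have : (r = p' + 1 ∧ t = q) ∨ (p' = r + 1 ∧ t = q) ∨ (r = p' ∧ t = q + 1) ∨
      (r = p' ∧ q = t + 1) := by omega
    rcases this with ⟨rfl, rfl⟩ | ⟨rfl, rfl⟩ | ⟨rfl, rfl⟩ | ⟨rfl, rfl⟩
    · exact (key _ _).2
    · rw [Sym2.eq_swap]; exact (key _ _).2
    · exact (key _ _).1
    · rw [Sym2.eq_swap]; exact (key _ _).1
  · intro x y hn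
    have : p.edges.count s(((x,y):Cell),(x,y+1)) = 0 := by
      rw [List.count_eq_zero]
      intro hm
      have := p.edges_subset_edgeSet hm
      exact hn ⟨this.1, this.2.1⟩
    simp [this]
  · intro x y hn
    have : p.edges.count s(((x,y):Cell),(x+1,y)) = 0 := by
      rw [List.count_eq_zero]
      intro hm
      have := p.edges_subset_edgeSet hm
      exact hn ⟨this.1, this.2.1⟩
    simp [this]
  · intro x y
    have h2 : ∀ a : ZMod 2, a + a = 0 := by decide
    have := nsq_walk_parity P x y p
    rw [h2] at this
    exact this

lemma nsq_support_le {V : Type*} [DecidableEq V] {G : SimpleGraph V} {u w : V} (p : G.Walk u w) :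
    p.support.toFinset.card ≤ p.edges.toFinset.card + 1 := by
  induction p with
  | nil => simp
  | @cons a b c hab p ih =>
    simp only [SimpleGraph.Walk.support_cons, SimpleGraph.Walk.edges_cons, List.toFinset_cons]
    by_cases h : a ∈ p.support
    · rw [Finset.insert_eq_of_mem (by simpa using h)]
      exact ih.trans (by gcongr; exact Finset.subset_insert _ _)
    · rw [Finset.card_insert_of_notMem (by simpa using h), Finset.card_insert_of_notMem]
      · omega
      · intro hm
        exact h (p.fst_mem_support_of_mem_edges (by simpa using hm))

lemma nsq_toWalk (P : Finset Cell) (w : ℕ → Cell) (n : ℕ) (h : IsWalk P w n) :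
    ∃ p : (nsqG P).Walk (w 0) (w n), p.length = n ∧ ∀ i ≤ n, w i ∈ p.support := by
  induction n with
  | zero => exact ⟨.nil, rfl, by simp⟩
  | succ n ih =>
    obtain ⟨p, hp, hs⟩ := ih ⟨fun i hi => h.1 i (by omega), fun i hi => h.2 i (by omega)⟩
    have hadj : (nsqG P).Adj (w n) (w (n+1)) :=
      ⟨h.1 _ (by omega), h.1 _ le_rfl, h.2 n (by omega)⟩
    refine ⟨p.concat hadj, by simp [hp], ?_⟩
    intro i hi
    rw [SimpleGraph.Walk.support_concat]
    rcases Nat.lt_or_ge n i with h1 | h1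
    · have : i = n + 1 := by omega
      simp [this]
    · simp [hs i h1]

lemma nsq_tour (P : Finset Cell) (hP : ConnectedUnder EdgeAdj (↑P : Set Cell))
    (s : Cell) (hs : s ∈ P) (k : ℕ) (hk : k + 1 ≤ P.card) :
    ∃ p : (nsqG P).Walk s s, p.length = 2 * k ∧ p.support.toFinset.card = k + 1 ∧
      p.support.toFinset ⊆ P := by
  induction k with
  | zero => exact ⟨.nil, by simp, by simp, by simpa using hs⟩
  | succ k ih =>
    obtain ⟨p, hl, hc, hsub⟩ := ih (by omega)
    obtain ⟨d, hd, hdn⟩ : ∃ d ∈ P, d ∉ p.support.toFinset := by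
      by_contra! hcon
      have := Finset.card_le_card hcon
      omega
    have := hP s hs d hd
    have step : ∀ d, Relation.ReflTransGen (fun a b => a ∈ (↑P : Set Cell) ∧ b ∈ (↑P : Set Cell) ∧ EdgeAdj a b) s d →
        d ∈ p.support ∨ ∃ a b, a ∈ p.support ∧ b ∉ p.support ∧ (nsqG P).Adj a b := by
      intro d hd
      induction hd with
      | refl => left; simp
      | @tail b c _ hb ih =>
        rcases ih with ih | ih
        · by_cases hc : c ∈ p.support
          · exact Or.inl hc
          · exact Or.inr ⟨b, c, ih, hc, hb⟩
        · exact Or.inr ih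
    rcases step d this with h | ⟨a, b, ha, hb, hab⟩
    · exact absurd (by simpa using h) hdn
    · have hspec := p.take_spec ha
      let q : (nsqG P).Walk s s := (p.takeUntil a ha).append
        (.cons hab (.cons hab.symm (p.dropUntil a ha)))
      have hq : q.support.toFinset = insert b p.support.toFinset := by
        ext c
        have h1 : c ∈ p.support ↔ c ∈ (p.takeUntil a ha).support ∨ c ∈ (p.dropUntil a ha).support := by
          conv_lhs => rw [← hspec]
          exact SimpleGraph.Walk.mem_support_append_iff _ _
        have h3 : a ∈ (p.dropUntil a ha).support := SimpleGraph.Walk.start_mem_support _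
        simp only [q, List.mem_toFinset, SimpleGraph.Walk.mem_support_append_iff,
          SimpleGraph.Walk.support_cons, List.mem_cons, Finset.mem_insert, h1]
        constructor
        · rintro (h | rfl | rfl | h) <;> tauto
        · tauto
      refine ⟨q, ?_, ?_, ?_⟩
      · have := congrArg SimpleGraph.Walk.length hspec
        simp only [q, SimpleGraph.Walk.length_append, SimpleGraph.Walk.length_cons] at this ⊢
        omega
      · rw [hq, Finset.card_insert_of_notMem (by simpa using hb), hc]
      · rw [hq]
        exact Finset.insert_subset hab.2.1 hsub

lemma nsq_length {α : Type*} [DecidableEq α] (L : List α) (h : ∀ e ∈ L, Even (L.count e)) :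
    2 * L.toFinset.card ≤ L.length := by
  rw [← List.sum_toFinset_count_eq_length, mul_comm, ← smul_eq_mul, ← Finset.sum_const]
  apply Finset.sum_le_sum
  intro e he
  have he' : e ∈ L := by simpa using he
  have := List.count_pos_iff.2 he'
  obtain ⟨k, hk⟩ := h e he'
  omega

lemma nsq_perim (P : Finset Cell) (hP : SimplePolygon P)
    (hsq : ¬ ∃ x y : ℤ, ((x, y) : Cell) ∈ P ∧ ((x + 1, y) : Cell) ∈ P ∧
      ((x, y + 1) : Cell) ∈ P ∧ ((x + 1, y + 1) : Cell) ∈ P) :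
    perimeter P = 2 * P.card + 2 := by
  classical
  have hac : (nsqG P).IsAcyclic := by
    intro u p hp
    cases p with
    | nil => simp at hp
    | @cons _ b _ hab p =>
      have h1 := nsq_even P hP.2 hsq _ s(u, b) (by simp : s(u,b) ∈ (SimpleGraph.Walk.cons hab p).edges)
      rw [List.count_eq_one_of_mem hp.edges_nodup (by simp)] at h1
      exact absurd h1 (by decide)
  let H := (nsqG P).induce (↑P : Set Cell)
  have hconn : H.Connected := by
    have hne : Nonempty (↑P : Set Cell) := by
      obtain ⟨c, hc⟩ := hP.1.1
      exact ⟨⟨c, hc⟩⟩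
    refine ⟨?_⟩
    rintro ⟨a, ha⟩ ⟨b, hb⟩
    have := hP.1.2 a ha b hb
    induction this with
    | refl => rfl
    | @tail c d _ hcd ih =>
      refine (ih hcd.1).trans ?_
      apply SimpleGraph.Adj.reachable
      exact hcd
  have htree : H.IsTree := ⟨hconn, hac.induce _⟩
  have hcard := htree.card_edgeFinset
  have hdeg := H.sum_degrees_eq_twice_card_edges
  have hcP : Fintype.card (↑P : Set Cell) = P.card := by simp
  have hd : ∀ c : (↑P : Set Cell), H.degree c = ((nbrs c).filter (fun d => d ∈ P)).card := by
    intro c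
    rw [← SimpleGraph.card_neighborFinset_eq_degree, ← Finset.card_map (Function.Embedding.subtype _)]
    congr 1
    ext d
    obtain ⟨⟨x, y⟩, hc⟩ := c
    obtain ⟨x', y'⟩ := d
    have hc' : (x, y) ∈ P := hc
    simp only [Finset.mem_map, SimpleGraph.mem_neighborFinset, Function.Embedding.coe_subtype,
      Finset.mem_filter, nbrs, Finset.mem_insert, Finset.mem_singleton, Prod.mk.injEq]
    constructor
    · rintro ⟨d, hd, hdd⟩
      have hd' : (x,y) ∈ P ∧ (x',y') ∈ P ∧ EdgeAdj (x,y) (x',y') := by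
        simpa [H, nsqG, hdd] using hd
      refine ⟨?_, hd'.2.1⟩
      have := hd'.2.2
      simp only [EdgeAdj] at this
      omega
    · rintro ⟨h, hm⟩
      refine ⟨⟨(x', y'), hm⟩, ⟨hc', hm, ?_⟩, rfl⟩
      change (x - x').natAbs + (y - y').natAbs = 1
      omega
  have h4 : ∀ c : Cell, (nbrs c).card = 4 := by
    rintro ⟨x, y⟩
    simp only [nbrs]
    rw [Finset.card_insert_of_notMem, Finset.card_insert_of_notMem, Finset.card_insert_of_notMem,
      Finset.card_singleton] <;> simp <;> omega
  have hsum : ∑ c ∈ P, ((nbrs c).filter (fun d => d ∈ P)).card = ∑ c, H.degree c := by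
    rw [← Finset.sum_coe_sort]
    exact (Finset.sum_congr rfl (fun c _ => hd c)).symm
  have htot : ∑ c ∈ P, ((nbrs c).filter (fun d => d ∈ P)).card + perimeter P = 4 * P.card := by
    rw [perimeter, ← Finset.sum_add_distrib, mul_comm, ← smul_eq_mul, ← Finset.sum_const]
    apply Finset.sum_congr rfl
    intro c _
    rw [Finset.card_filter_add_card_filter_not, h4]
  rw [hcP] at hcard
  omega

/-- in a simple grid polygon with `C ≥ 2` cells and no 2×2 square
of free cells, the minimum length of a closed covering walk from any `s ∈ P`
is exactly `2C - 2`; in particular the bound `C + E/2 - 3` is attained. -/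
theorem no_square_min_tour_length (P : Finset Cell) (hP : SimplePolygon P)
    (hC : 2 ≤ P.card)
    (hsq : ¬ ∃ x y : ℤ, ((x, y) : Cell) ∈ P ∧ ((x + 1, y) : Cell) ∈ P ∧
      ((x, y + 1) : Cell) ∈ P ∧ ((x + 1, y + 1) : Cell) ∈ P)
    (s : Cell) (hs : s ∈ P) :
    IsLeast {n : ℕ | ∃ w : ℕ → Cell,
        w 0 = s ∧ IsWalk P w n ∧ w n = s ∧ Covers P w n}
      (2 * P.card - 2) ∧
    2 * P.card - 2 = P.card + perimeter P / 2 - 3 := by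
  refine ⟨⟨?_, ?_⟩, ?_⟩
  · obtain ⟨p, hl, hc, hsub⟩ := nsq_tour P hP.1.2 s hs (P.card - 1) (by omega)
    have hl' : p.length = 2 * P.card - 2 := by omega
    have heq : p.support.toFinset = P := Finset.eq_of_subset_of_card_le hsub (by omega)
    refine ⟨p.getVert, by simp, ⟨?_, ?_⟩, ?_, ?_⟩
    · intro i _
      apply hsub
      simpa using p.getVert_mem_support i
    · intro i hi
      exact (p.adj_getVert_succ (by omega)).2.2
    · rw [← hl']; simp
    · intro c hc
      rw [← heq, List.mem_toFinset, SimpleGraph.Walk.mem_support_iff_exists_getVert] at hc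
      obtain ⟨n, hn, hle⟩ := hc
      exact ⟨n, by omega, hn⟩
  · rintro n ⟨w, rfl, hw, hn, hcov⟩
    obtain ⟨p, hl, hsup⟩ := nsq_toWalk P w n hw
    obtain ⟨q, hql, hqs⟩ : ∃ q : (nsqG P).Walk (w 0) (w 0), q.length = n ∧
        ∀ i ≤ n, w i ∈ q.support := ⟨p.copy rfl hn, by simpa using hl, by simpa using hsup⟩
    have h1 := nsq_length q.edges (fun e he => nsq_even P hP.2 hsq q e he)
    have h2 := nsq_support_le q
    have h3 : P.card ≤ q.support.toFinset.card := by
      apply Finset.card_le_card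
      intro c hc
      obtain ⟨i, hi, rfl⟩ := hcov c hc
      simpa using hqs i hi
    rw [SimpleGraph.Walk.length_edges] at h1
    omega
  · rw [nsq_perim P hP hsq]
    omega
end
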